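/- arXiv:1906.00940 — 9 statements merged into one kernel-verified Lean document; each statement's English description precedes it below -/
import Mathlib

section
/- Let N ≥ 1 and let t be a tempered distribution on ℝ^N. Suppose t has the value c ∈ ℂ at the origin in the sense of Łojasiewicz, i.e. for every Schwartz function g ∈ 𝓢(ℝ^N) with ∫_{ℝ^N} g(q) dq = 1 one has lim_{ε→0⁺} ⟨t, g_ε⟩ = c, where g_ε(q) := ε^{−N} g(q/ε). Let h : ℝ^N → ℂ be a smooth function of temperate growth, i.e. for every multi-index α there are C > 0 and k ∈ ℕ with |∂^α h(q)| ≤ C (1+|q|)^k for all q. Then the product distribution h·t (defined by ⟨h·t, φ⟩ := ⟨t, h·φ⟩, h·φ ∈ 𝓢(ℝ^N)) has the value h(0)·c at the origin: for every g ∈ 𝓢(ℝ^N) with ∫ g = 1, lim_{ε→0⁺} ⟨t, h·g_ε⟩ = h(0)·c. -/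
open MeasureTheory Filter Topology

section Helpers

open Set SchwartzMap
open scoped ContDiff Interval

universe u

namespace Function.HasTemperateGrowth

variable {E F : Type*} [NormedAddCommGroup E] [NormedSpace ℝ E]
  [NormedAddCommGroup F] [NormedSpace ℝ F]

theorem fderiv_right {f : E → F} (hf : f.HasTemperateGrowth) :
    (fderiv ℝ f).HasTemperateGrowth := by
  refine ⟨hf.1.fderiv_right (by simp), fun n => ?_⟩
  simpa only [norm_iteratedFDeriv_fderiv] using hf.2 (n + 1)

/-- A single polynomial bound valid along the whole segment from the origin. -/
theorem exists_norm_smul_le {f : E → F} (hf : f.HasTemperateGrowth) (m : ℕ) :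
    ∃ (k : ℕ) (C : ℝ), 0 ≤ C ∧ ∀ s ∈ Ι (0 : ℝ) 1, ∀ x,
      ‖s ^ m • f (s • x)‖ ≤ C * (1 + ‖x‖) ^ k := by
  obtain ⟨k, C, hC, h⟩ := hf.norm_iteratedFDeriv_le_uniform 0
  refine ⟨k, C, hC, fun s hs x => ?_⟩
  rw [uIoc_of_le zero_le_one] at hs
  have h1 : ‖f (s • x)‖ ≤ C * (1 + ‖s • x‖) ^ k := by simpa using h 0 le_rfl (s • x)
  have h2 : ‖s • x‖ ≤ ‖x‖ := by
    rw [norm_smul, Real.norm_of_nonneg hs.1.le]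
    exact mul_le_of_le_one_left (norm_nonneg _) hs.2
  have h3 : ‖s ^ m‖ ≤ 1 := by
    rw [Real.norm_of_nonneg (pow_nonneg hs.1.le _)]
    exact pow_le_one₀ hs.1.le hs.2
  rw [norm_smul]
  calc ‖s ^ m‖ * ‖f (s • x)‖ ≤ 1 * (C * (1 + ‖s • x‖) ^ k) := by gcongr
    _ ≤ C * (1 + ‖x‖) ^ k := by rw [one_mul]; gcongr

theorem norm_integral_pow_smul_comp_smul_le {f : E → F} (hf : f.HasTemperateGrowth) (m : ℕ) :
    ∃ (k : ℕ) (C : ℝ), ∀ x,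
      ‖∫ s in (0 : ℝ)..1, s ^ m • f (s • x)‖ ≤ C * (1 + ‖x‖) ^ k := by
  obtain ⟨k, C, -, h⟩ := hf.exists_norm_smul_le m
  refine ⟨k, C, fun x => ?_⟩
  simpa using intervalIntegral.norm_integral_le_of_norm_le_const fun s hs => h s hs x

theorem hasFDerivAt_integral_pow_smul_comp_smul {f : E → F} (hf : f.HasTemperateGrowth)
    (m : ℕ) (x₀ : E) :
    HasFDerivAt (fun x => ∫ s in (0 : ℝ)..1, s ^ m • f (s • x))
      (∫ s in (0 : ℝ)..1, s ^ (m + 1) • fderiv ℝ f (s • x₀)) x₀ := by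
  obtain ⟨k, C, hC, h⟩ := hf.fderiv_right.exists_norm_smul_le (m + 1)
  have hcont : Continuous f := hf.1.continuous
  have hcont' : Continuous (fderiv ℝ f) := hf.fderiv_right.1.continuous
  have hdiff : Differentiable ℝ f := hf.1.differentiable (by simp)
  refine intervalIntegral.hasFDerivAt_integral_of_dominated_of_fderiv_le
    (F' := fun x s => s ^ (m + 1) • fderiv ℝ f (s • x))
    (bound := fun _ => C * (1 + (‖x₀‖ + 1)) ^ k)
    (Metric.ball_mem_nhds x₀ one_pos) (.of_forall fun x => ?_) ?_ ?_ ?_ ?_ ?_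
  · exact Continuous.aestronglyMeasurable (by fun_prop)
  · exact Continuous.intervalIntegrable (by fun_prop) _ _
  · exact Continuous.aestronglyMeasurable (by fun_prop)
  · refine .of_forall fun s hs x hx => (h s hs x).trans ?_
    have : ‖x‖ ≤ ‖x₀‖ + 1 := by
      have := norm_sub_norm_le x x₀
      rw [mem_ball_iff_norm] at hx
      linarith
    gcongr
  · exact Continuous.intervalIntegrable (by fun_prop) _ _
  · refine .of_forall fun s _ x _ => ?_
    have h1 : HasFDerivAt (fun y : E => s • y) (s • ContinuousLinearMap.id ℝ E) x :=
      (hasFDerivAt_id x).const_smul s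
    have h2 := ((hdiff (s • x)).hasFDerivAt.comp x h1).const_smul (s ^ m)
    convert! h2 using 1
    ext v
    simp [pow_succ, mul_smul]

theorem contDiff_integral_pow_smul_comp_smul {E : Type u} [NormedAddCommGroup E] [NormedSpace ℝ E]
    (n : ℕ) : ∀ {F : Type u} [NormedAddCommGroup F] [NormedSpace ℝ F] {f : E → F},
      f.HasTemperateGrowth → ∀ m : ℕ,
      ContDiff ℝ n (fun x => ∫ s in (0 : ℝ)..1, s ^ m • f (s • x)) ∧
      ∃ (k : ℕ) (C : ℝ), ∀ x,
        ‖iteratedFDeriv ℝ n (fun x => ∫ s in (0 : ℝ)..1, s ^ m • f (s • x)) x‖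
          ≤ C * (1 + ‖x‖) ^ k := by
  induction n with
  | zero =>
    intro F _ _ f hf m
    refine ⟨contDiff_zero.2 ?_, by simpa using hf.norm_integral_pow_smul_comp_smul_le m⟩
    exact continuous_iff_continuousAt.2 fun x =>
      (hf.hasFDerivAt_integral_pow_smul_comp_smul m x).continuousAt
  | succ n ih =>
    intro F _ _ f hf m
    have hd := hf.hasFDerivAt_integral_pow_smul_comp_smul m
    have hfd : fderiv ℝ (fun x => ∫ s in (0 : ℝ)..1, s ^ m • f (s • x)) =
        fun x => ∫ s in (0 : ℝ)..1, s ^ (m + 1) • fderiv ℝ f (s • x) :=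
      funext fun x => (hd x).fderiv
    obtain ⟨h1, h2⟩ := ih hf.fderiv_right (m + 1)
    refine ⟨?_, ?_⟩
    · rw [Nat.cast_succ, contDiff_succ_iff_fderiv, hfd]
      exact ⟨fun x => (hd x).differentiableAt, by simp, h1⟩
    · simpa only [← norm_iteratedFDeriv_fderiv, hfd] using h2

theorem integral_comp_smul {E F : Type u} [NormedAddCommGroup E] [NormedSpace ℝ E]
    [NormedAddCommGroup F] [NormedSpace ℝ F] {f : E → F} (hf : f.HasTemperateGrowth) :
    (fun x => ∫ s in (0 : ℝ)..1, f (s • x)).HasTemperateGrowth := by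
  refine ⟨contDiff_infty.2 fun n => ?_, fun n => ?_⟩
  · simpa using (contDiff_integral_pow_smul_comp_smul n hf 0).1
  · simpa using (contDiff_integral_pow_smul_comp_smul n hf 0).2

end Function.HasTemperateGrowth

/-- **Hadamard's lemma** for functions of temperate growth. -/
theorem Function.HasTemperateGrowth.exists_eq_add_sum_mul {ι : Type} [Fintype ι]
    {h : EuclideanSpace ℝ ι → ℂ} (hh : h.HasTemperateGrowth) :
    ∃ k : ι → EuclideanSpace ℝ ι → ℂ, (∀ i, (k i).HasTemperateGrowth) ∧
      ∀ x, h x = h 0 + ∑ i, (x i : ℂ) * k i x := by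
  classical
  let D : EuclideanSpace ℝ ι → (EuclideanSpace ℝ ι →L[ℝ] ℂ) :=
    fun x => ∫ s in (0 : ℝ)..1, fderiv ℝ h (s • x)
  have hD : D.HasTemperateGrowth := hh.fderiv_right.integral_comp_smul
  have hcont : Continuous (fderiv ℝ h) := hh.fderiv_right.1.continuous
  refine ⟨fun i x => D x (EuclideanSpace.single i 1), fun i => ?_, fun x => ?_⟩
  · exact (ContinuousLinearMap.apply ℝ ℂ (EuclideanSpace.single i (1 : ℝ))).hasTemperateGrowth.comp
      hD
  · have hderiv (s : ℝ) : HasDerivAt (fun s : ℝ => h (s • x)) (fderiv ℝ h (s • x) x) s := by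
      have h1 := ((hh.1.differentiable (by simp)) (s • x)).hasFDerivAt
      simpa using! h1.comp_hasDerivAt s ((hasDerivAt_id s).smul_const x)
    have hint := intervalIntegral.integral_eq_sub_of_hasDerivAt (a := 0) (b := 1)
      (fun s _ => hderiv s) (Continuous.intervalIntegrable (by fun_prop) _ _)
    have hDx : D x x = h x - h 0 := by
      rw [ContinuousLinearMap.intervalIntegral_apply
        (Continuous.intervalIntegrable (by fun_prop) _ _), hint]
      simp
    have hx : x = ∑ i, x i • EuclideanSpace.single i (1 : ℝ) := by
      simpa using ((EuclideanSpace.basisFun ι ℝ).sum_repr x).symm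
    have hL (L : EuclideanSpace ℝ ι →L[ℝ] ℂ) :
        L x = ∑ i, (x i : ℂ) * L (EuclideanSpace.single i 1) := by
      conv_lhs => rw [hx, map_sum]
      simp
    rw [← hL (D x), hDx]
    ring

section Rescale

variable {ι : Type} [Fintype ι]

/-- The `L¹`-normalised dilation `g ↦ ε⁻ᴺ g(ε⁻¹ ·)` of Schwartz functions on `ℝᴺ`
(zero for `ε = 0`). -/
noncomputable def SchwartzMap.rescale (ε : ℝ) :
    𝓢(EuclideanSpace ℝ ι, ℂ) →L[ℂ] 𝓢(EuclideanSpace ℝ ι, ℂ) :=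
  if hε : ε = 0 then 0 else
    (ε : ℂ) ^ (-(Fintype.card ι : ℤ)) • compCLMOfContinuousLinearEquiv ℂ
      (LinearEquiv.smulOfNeZero ℝ (EuclideanSpace ℝ ι) ε⁻¹
        (inv_ne_zero hε)).toContinuousLinearEquiv

theorem SchwartzMap.rescale_apply {ε : ℝ} (hε : ε ≠ 0) (g : 𝓢(EuclideanSpace ℝ ι, ℂ))
    (q : EuclideanSpace ℝ ι) :
    rescale ε g q = (ε : ℂ) ^ (-(Fintype.card ι : ℤ)) * g (ε⁻¹ • q) := by
  simp [rescale, hε]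

theorem SchwartzMap.norm_iteratedFDeriv_rescale {ε : ℝ} (hε : 0 < ε)
    (g : 𝓢(EuclideanSpace ℝ ι, ℂ)) (n : ℕ) (q : EuclideanSpace ℝ ι) :
    ‖iteratedFDeriv ℝ n (rescale ε g) q‖ =
      ε⁻¹ ^ (Fintype.card ι + n) * ‖iteratedFDeriv ℝ n g (ε⁻¹ • q)‖ := by
  have h1 : (rescale ε g : EuclideanSpace ℝ ι → ℂ) =
      fun q => (ε : ℂ) ^ (-(Fintype.card ι : ℤ)) • g (ε⁻¹ • q) :=
    funext fun q => rescale_apply hε.ne' g q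
  have hg : ContDiff ℝ n g := g.smooth n
  rw [h1, iteratedFDeriv_const_smul_apply' (by fun_prop), norm_smul,
    iteratedFDeriv_comp_const_smul _ hg, norm_smul, pow_add, mul_assoc]
  simp [abs_of_pos hε]

theorem SchwartzMap.exists_seminorm_smulLeftCLM_rescale_le {h : EuclideanSpace ℝ ι → ℂ}
    (hh : h.HasTemperateGrowth) (g : 𝓢(EuclideanSpace ℝ ι, ℂ)) (k n : ℕ) :
    ∃ C : ℝ, ∀ ε ∈ Ioc (0 : ℝ) 1,
      SchwartzMap.seminorm ℂ k n (smulLeftCLM ℂ h (rescale ε g)) ≤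
        C * ε⁻¹ ^ (Fintype.card ι + n) := by
  obtain ⟨l, A, hA, hbound⟩ := hh.norm_iteratedFDeriv_le_uniform n
  set B : ℝ := 2 ^ (k + l) *
    (Finset.Iic (k + l, n)).sup (fun m => SchwartzMap.seminorm ℂ m.1 m.2) g with hB
  have hB0 : 0 ≤ B := by positivity
  refine ⟨∑ i ∈ Finset.range (n + 1), n.choose i * (A * B), fun ε hε => ?_⟩
  have hε1 : 1 ≤ ε⁻¹ := (one_le_inv₀ hε.1).2 hε.2
  refine seminorm_le_bound ℂ k n _ (by positivity) fun x => ?_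
  have hx : ‖x‖ ≤ ‖ε⁻¹ • x‖ := by
    rw [norm_smul, Real.norm_of_nonneg (by positivity)]
    exact le_mul_of_one_le_left (norm_nonneg _) hε1
  rw [smulLeftCLM_apply hh]
  grw [norm_iteratedFDeriv_smul_le hh.1 ((rescale ε g).smooth ⊤) x (mod_cast le_top)]
  rw [Finset.mul_sum, Finset.sum_mul]
  refine Finset.sum_le_sum fun i hi => ?_
  have hi : i ≤ n := Finset.mem_range_succ_iff.1 hi
  rw [norm_iteratedFDeriv_rescale hε.1]
  have hg := one_add_le_sup_seminorm_apply (𝕜 := ℂ) (m := (k + l, n)) (le_refl (k + l))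
    (Nat.sub_le n i) g (ε⁻¹ • x)
  calc ‖x‖ ^ k * (n.choose i * ‖iteratedFDeriv ℝ i h x‖ *
        (ε⁻¹ ^ (Fintype.card ι + (n - i)) * ‖iteratedFDeriv ℝ (n - i) g (ε⁻¹ • x)‖))
      ≤ (1 + ‖ε⁻¹ • x‖) ^ k * (n.choose i * (A * (1 + ‖ε⁻¹ • x‖) ^ l) *
        (ε⁻¹ ^ (Fintype.card ι + n) * ‖iteratedFDeriv ℝ (n - i) g (ε⁻¹ • x)‖)) := by
        gcongr
        · linarith
        · exact (hbound i hi x).trans (by gcongr)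
        · exact Nat.sub_le n i
    _ = n.choose i * (A * ((1 + ‖ε⁻¹ • x‖) ^ (k + l) *
          ‖iteratedFDeriv ℝ (n - i) g (ε⁻¹ • x)‖)) * ε⁻¹ ^ (Fintype.card ι + n) := by
        ring
    _ ≤ n.choose i * (A * B) * ε⁻¹ ^ (Fintype.card ι + n) := by gcongr

/-- A tempered distribution has finite order at the origin, uniformly in the multiplier `h`. -/
theorem SchwartzMap.exists_isBigO_smulLeftCLM_rescale (t : 𝓢(EuclideanSpace ℝ ι, ℂ) →L[ℂ] ℂ) :
    ∃ M : ℕ, ∀ h : EuclideanSpace ℝ ι → ℂ, h.HasTemperateGrowth → ∀ g,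
      (fun ε => t (smulLeftCLM ℂ h (rescale ε g))) =O[𝓝[>] (0 : ℝ)] fun ε => ε⁻¹ ^ M := by
  obtain ⟨s, C, -, hC⟩ := Seminorm.bound_of_continuous
    (schwartz_withSeminorms ℂ (EuclideanSpace ℝ ι) ℂ) ((normSeminorm ℂ ℂ).comp t.toLinearMap)
    (continuous_norm.comp t.continuous)
  refine ⟨Fintype.card ι + s.sup Prod.snd, fun h hh g => ?_⟩
  choose K hK using exists_seminorm_smulLeftCLM_rescale_le hh g
  refine Asymptotics.IsBigO.of_bound (C * ∑ i ∈ s, |K i.1 i.2|) ?_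
  filter_upwards [Ioc_mem_nhdsGT (zero_lt_one' ℝ)] with ε hε
  have hε1 : 1 ≤ ε⁻¹ := (one_le_inv₀ hε.1).2 hε.2
  have hε0 : 0 < ε := hε.1
  rw [Real.norm_of_nonneg (by positivity)]
  calc ‖t (smulLeftCLM ℂ h (rescale ε g))‖
      ≤ C * s.sup (schwartzSeminormFamily ℂ _ ℂ) (smulLeftCLM ℂ h (rescale ε g)) := hC _
    _ ≤ C * ∑ i ∈ s, schwartzSeminormFamily ℂ _ ℂ i (smulLeftCLM ℂ h (rescale ε g)) := by
        gcongr
        simpa using Seminorm.finset_sup_le_sum (schwartzSeminormFamily ℂ _ ℂ) s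
          (smulLeftCLM ℂ h (rescale ε g))
    _ ≤ C * ∑ i ∈ s, |K i.1 i.2| * ε⁻¹ ^ (Fintype.card ι + s.sup Prod.snd) := by
        gcongr with i hi
        refine (hK i.1 i.2 ε hε).trans ?_
        gcongr
        · exact le_abs_self _
        · exact Finset.le_sup (f := Prod.snd) hi
    _ = C * (∑ i ∈ s, |K i.1 i.2|) * ε⁻¹ ^ (Fintype.card ι + s.sup Prod.snd) := by
        rw [mul_assoc, Finset.sum_mul]

/-- First-order expansion of a multiplier applied to a dilated Schwartz function. -/
theorem SchwartzMap.smulLeftCLM_rescale_eq {h : EuclideanSpace ℝ ι → ℂ}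
    (hh : h.HasTemperateGrowth) {k : ι → EuclideanSpace ℝ ι → ℂ}
    (hk : ∀ i, (k i).HasTemperateGrowth) (hhk : ∀ x, h x = h 0 + ∑ i, (x i : ℂ) * k i x)
    (g : 𝓢(EuclideanSpace ℝ ι, ℂ)) {ε : ℝ} (hε : ε ≠ 0) :
    smulLeftCLM ℂ h (rescale ε g) = h 0 • rescale ε g + (ε : ℂ) • ∑ i,
      smulLeftCLM ℂ (k i) (rescale ε
        (smulLeftCLM ℂ (fun x : EuclideanSpace ℝ ι => (x i : ℂ)) g)) := by
  have hx (i : ι) : (fun x : EuclideanSpace ℝ ι => (x i : ℂ)).HasTemperateGrowth :=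
    (Complex.ofRealCLM.comp (EuclideanSpace.proj i)).hasTemperateGrowth
  have hε' : (ε : ℂ) ≠ 0 := mod_cast hε
  ext q
  simp only [smulLeftCLM_apply_apply hh, add_apply, smul_apply, sum_apply,
    smulLeftCLM_apply_apply (hk _), rescale_apply hε, smulLeftCLM_apply_apply (hx _), smul_eq_mul]
  rw [hhk q, add_mul, Finset.mul_sum, Finset.sum_mul]
  congr 1
  refine Finset.sum_congr rfl fun i _ => ?_
  simp
  field_simp

theorem SchwartzMap.tendsto_smulLeftCLM_rescale {t : 𝓢(EuclideanSpace ℝ ι, ℂ) →L[ℂ] ℂ}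
    {c : 𝓢(EuclideanSpace ℝ ι, ℂ) → ℂ}
    (ht : ∀ g, Tendsto (fun ε => t (rescale ε g)) (𝓝[>] (0 : ℝ)) (𝓝 (c g)))
    {h : EuclideanSpace ℝ ι → ℂ} (hh : h.HasTemperateGrowth) (g : 𝓢(EuclideanSpace ℝ ι, ℂ)) :
    Tendsto (fun ε => t (smulLeftCLM ℂ h (rescale ε g))) (𝓝[>] (0 : ℝ)) (𝓝 (h 0 * c g)) := by
  have expand {h : EuclideanSpace ℝ ι → ℂ} (hh : h.HasTemperateGrowth)
      {k : ι → EuclideanSpace ℝ ι → ℂ} (hk : ∀ i, (k i).HasTemperateGrowth)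
      (hhk : ∀ x, h x = h 0 + ∑ i, (x i : ℂ) * k i x) (g : 𝓢(EuclideanSpace ℝ ι, ℂ)) :
      (fun ε => h 0 * t (rescale ε g) + (ε : ℂ) * ∑ i, t (smulLeftCLM ℂ (k i) (rescale ε
        (smulLeftCLM ℂ (fun x : EuclideanSpace ℝ ι => (x i : ℂ)) g)))) =ᶠ[𝓝[>] (0 : ℝ)]
      fun ε => t (smulLeftCLM ℂ h (rescale ε g)) := by
    filter_upwards [self_mem_nhdsWithin] with ε hε
    rw [smulLeftCLM_rescale_eq hh hk hhk g (ne_of_gt hε)]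
    simp
  have bounded : ∀ M : ℕ, (∀ h : EuclideanSpace ℝ ι → ℂ, h.HasTemperateGrowth → ∀ g,
      (fun ε => t (smulLeftCLM ℂ h (rescale ε g))) =O[𝓝[>] (0 : ℝ)] fun ε => ε⁻¹ ^ M) →
      ∀ h : EuclideanSpace ℝ ι → ℂ, h.HasTemperateGrowth → ∀ g,
      (fun ε => t (smulLeftCLM ℂ h (rescale ε g))) =O[𝓝[>] (0 : ℝ)] fun _ => (1 : ℝ) := by
    intro M
    induction M with
    | zero => simp
    | succ M ih =>
      intro H
      refine ih fun h hh g => ?_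
      obtain ⟨k, hk, hhk⟩ := hh.exists_eq_add_sum_mul
      refine Asymptotics.IsBigO.congr' (.add ?_ ?_) (expand hh hk hhk g) .rfl
      · refine (((ht g).isBigO_one ℝ).const_mul_left _).trans (.of_bound 1 ?_)
        filter_upwards [Ioc_mem_nhdsGT (zero_lt_one' ℝ)] with ε hε
        have hε1 : 1 ≤ ε⁻¹ := (one_le_inv₀ hε.1).2 hε.2
        have : 1 ≤ ε⁻¹ ^ M := one_le_pow₀ hε1
        simpa using this.trans (le_abs_self _)
      · have h1 : (fun ε : ℝ => (ε : ℂ)) =O[𝓝[>] (0 : ℝ)] fun ε : ℝ => ε :=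
          .of_bound 1 (by simp)
        refine (h1.mul (.fun_sum fun i _ => H (k i) (hk i) _)).congr' .rfl ?_
        filter_upwards [self_mem_nhdsWithin] with ε hε
        rw [pow_succ', mul_inv_cancel_left₀ (ne_of_gt hε)]
  obtain ⟨M, hM⟩ := exists_isBigO_smulLeftCLM_rescale t
  obtain ⟨k, hk, hhk⟩ := hh.exists_eq_add_sum_mul
  refine Tendsto.congr' (expand hh hk hhk g) ?_
  have hzero : Tendsto (fun ε : ℝ => (ε : ℂ)) (𝓝[>] (0 : ℝ)) (𝓝 0) :=
    (Complex.continuous_ofReal.tendsto' 0 0 (by simp)).mono_left nhdsWithin_le_nhds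
  have hsum : (fun ε => ∑ i, t (smulLeftCLM ℂ (k i) (rescale ε
      (smulLeftCLM ℂ (fun x : EuclideanSpace ℝ ι => (x i : ℂ)) g)))) =O[𝓝[>] (0 : ℝ)]
      fun _ => (1 : ℝ) := .fun_sum fun i _ => bounded M hM (k i) (hk i) _
  have hrem := ((Asymptotics.isLittleO_one_iff ℝ).2 hzero).mul_isBigO hsum
  simp only [mul_one] at hrem
  simpa using ((ht g).const_mul (h 0)).add ((Asymptotics.isLittleO_one_iff ℝ).1 hrem)

end Rescale

end Helpers

/-- **Łojasiewicz value of a tempered distribution is preserved under multiplication by a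
smooth function of temperate growth.**

Let `t` be a tempered distribution on `ℝ^N` having the value `c` at the origin in the sense of
Łojasiewicz: for every Schwartz `g` with `∫ g = 1` and every Schwartz family `G ε` equal to
`q ↦ ε^{-N} g(q/ε)` for `ε > 0`, one has `⟨t, G ε⟩ → c` as `ε → 0⁺`.  Let `h` be smooth of
temperate growth.  Then the product distribution `h · t` has the value `h 0 * c` at the origin:
for every such `g` and family `G`, and every Schwartz family `H ε` equal pointwise to
`h · (G ε)`, one has `⟨t, H ε⟩ → h 0 * c` as `ε → 0⁺`. -/
theorem lojasiewicz_value_smul_temperate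
    (N : ℕ) (hN : 1 ≤ N)
    (t : SchwartzMap (EuclideanSpace ℝ (Fin N)) ℂ →L[ℂ] ℂ)
    (c : ℂ)
    (h : EuclideanSpace ℝ (Fin N) → ℂ)
    (hh : Function.HasTemperateGrowth h)
    (ht : ∀ g : SchwartzMap (EuclideanSpace ℝ (Fin N)) ℂ,
      (∫ q, g q) = 1 →
      ∀ G : ℝ → SchwartzMap (EuclideanSpace ℝ (Fin N)) ℂ,
        (∀ ε : ℝ, 0 < ε → ∀ q, G ε q = (ε : ℂ) ^ (-(N : ℤ)) * g (ε⁻¹ • q)) →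
        Tendsto (fun ε => t (G ε)) (𝓝[>] (0 : ℝ)) (𝓝 c)) :
    ∀ g : SchwartzMap (EuclideanSpace ℝ (Fin N)) ℂ,
      (∫ q, g q) = 1 →
      ∀ G : ℝ → SchwartzMap (EuclideanSpace ℝ (Fin N)) ℂ,
        (∀ ε : ℝ, 0 < ε → ∀ q, G ε q = (ε : ℂ) ^ (-(N : ℤ)) * g (ε⁻¹ • q)) →
        ∀ H : ℝ → SchwartzMap (EuclideanSpace ℝ (Fin N)) ℂ,
          (∀ ε : ℝ, 0 < ε → ∀ q, H ε q = h q * G ε q) →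
          Tendsto (fun ε => t (H ε)) (𝓝[>] (0 : ℝ)) (𝓝 (h 0 * c)) := by
  intro g hg G hG H hH
  have hrescale (g' : SchwartzMap (EuclideanSpace ℝ (Fin N)) ℂ) (ε : ℝ) (hε : 0 < ε)
      (q : EuclideanSpace ℝ (Fin N)) :
      SchwartzMap.rescale ε g' q = (ε : ℂ) ^ (-(N : ℤ)) * g' (ε⁻¹ • q) := by
    simpa using SchwartzMap.rescale_apply hε.ne' g' q
  have hvalue (g' : SchwartzMap (EuclideanSpace ℝ (Fin N)) ℂ) :
      Tendsto (fun ε => t (SchwartzMap.rescale ε g')) (𝓝[>] (0 : ℝ)) (𝓝 ((∫ q, g' q) * c)) := by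
    set a : ℂ := ∫ q, g' q with ha
    have hint : (∫ q, (g' - (a - 1) • g) q) = 1 := by
      have := map_sub (SchwartzMap.integralCLM ℂ volume) g' ((a - 1) • g)
      rw [map_smul] at this
      simp only [SchwartzMap.integralCLM_apply, hg, ← ha] at this
      simpa using this
    have hlim := (ht _ hint _ (hrescale _)).add ((ht g hg _ (hrescale g)).const_mul (a - 1))
    simpa [map_sub, sub_mul] using hlim
  have hmain := SchwartzMap.tendsto_smulLeftCLM_rescale hvalue hh g
  rw [hg, one_mul] at hmain
  refine hmain.congr' ?_
  filter_upwards [self_mem_nhdsWithin] with ε hε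
  congr 1
  ext q
  rw [SchwartzMap.smulLeftCLM_apply_apply hh, hH ε hε, hG ε hε, hrescale g ε hε, smul_eq_mul]
end

section
/- Let G ∈ 𝓢(ℝ⁴, ℂ) be a Schwartz function. Then for every ε > 0, ∫_{(ℝ³)⁴} [∏_{i=1}^{4} d³k⃗ᵢ/((2π)³ 2|k⃗ᵢ|)] · ε^{−8} |G( (|k⃗₁|+|k⃗₂|+|k⃗₃|+|k⃗₄|)/ε , (k⃗₁+k⃗₂+k⃗₃+k⃗₄)/ε )|² = ∫_{(ℝ³)⁴} [∏_{i=1}^{4} d³k⃗ᵢ/((2π)³ 2|k⃗ᵢ|)] |G( |k⃗₁|+|k⃗₂|+|k⃗₃|+|k⃗₄| , k⃗₁+k⃗₂+k⃗₃+k⃗₄ )|², and both integrals are finite. (Thus the L² norm of the first-order vacuum-decay amplitude in the massless φ⁴ model is independent of the adiabatic parameter ε, so this amplitude has no strong adiabatic limit unless it vanishes identically.) -/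
open MeasureTheory Filter Topology Real

noncomputable section

/-- Three-dimensional Euclidean space `ℝ³`. -/
abbrev V3 : Type := EuclideanSpace ℝ (Fin 3)

/-- In three dimensions `‖x‖⁻¹ (1 + ‖x‖)⁻⁴` is integrable. -/
theorem integrable_inv_norm_mul_one_add_norm_pow :
    Integrable (fun x : V3 => ‖x‖⁻¹ * ((1 + ‖x‖) ^ 4)⁻¹) := by
  rw [integrable_fun_norm_addHaar volume (f := fun r : ℝ => r⁻¹ * ((1 + r) ^ 4)⁻¹)]
  have hdom : Integrable (fun x : ℝ => (1 + ‖x‖) ^ (-(2 : ℝ))) volume :=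
    integrable_one_add_norm (by simp)
  refine Integrable.mono' hdom.integrableOn ?_ ?_
  · exact Measurable.aestronglyMeasurable (by fun_prop)
  · filter_upwards [ae_restrict_mem measurableSet_Ioi] with y (hy : 0 < y)
    have h1 : 0 < 1 + y := by linarith
    rw [Real.norm_of_nonneg hy.le, rpow_neg h1.le, finrank_euclideanSpace_fin, smul_eq_mul,
      Real.norm_of_nonneg (by positivity), show (2 : ℝ) = (2 : ℕ) by norm_num, rpow_natCast]
    have h2 : y ^ (3 - 1) * (y⁻¹ * ((1 + y) ^ 4)⁻¹) = y / (1 + y) ^ 4 := by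
      norm_num
      field_simp
    rw [h2, ← one_div, div_le_div_iff₀ (by positivity) (by positivity)]
    nlinarith [mul_nonneg hy.le (sq_nonneg (1 + y)), sq_nonneg (1 + y), sq_nonneg y,
      mul_nonneg (sq_nonneg y) (sq_nonneg (1 + y))]

/-- Change of variables `x ↦ c⁻¹ • x` in a lower Lebesgue integral. -/
theorem lintegral_comp_inv_smul_addHaar {E : Type*} [NormedAddCommGroup E] [NormedSpace ℝ E]
    [MeasurableSpace E] [BorelSpace E] [FiniteDimensional ℝ E] (μ : Measure E)
    [μ.IsAddHaarMeasure] (f : E → ENNReal) {c : ℝ} (hc : 0 < c) :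
    ∫⁻ x, f (c⁻¹ • x) ∂μ = ENNReal.ofReal (c ^ Module.finrank ℝ E) * ∫⁻ x, f x ∂μ := by
  have hne : c⁻¹ ≠ 0 := inv_ne_zero hc.ne'
  have h := lintegral_map_equiv (μ := μ) f (Homeomorph.smulOfNeZero c⁻¹ hne).toMeasurableEquiv
  have hmap : μ.map (Homeomorph.smulOfNeZero (α := E) c⁻¹ hne).toMeasurableEquiv =
      ENNReal.ofReal (c ^ Module.finrank ℝ E) • μ := by
    have h' := Measure.map_addHaar_smul μ hne
    rw [inv_pow, inv_inv, abs_of_pos (by positivity)] at h'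
    exact h'
  rw [hmap, lintegral_smul_measure] at h
  exact h.symm

/-- Lebesgue measure on a product of two spaces is a Haar measure if it is on the factors. -/
theorem isAddHaarMeasure_volume_prod (E F : Type*)
    [NormedAddCommGroup E] [MeasureSpace E] [BorelSpace E] [SecondCountableTopology E]
    [NormedAddCommGroup F] [MeasureSpace F] [BorelSpace F] [SecondCountableTopology F]
    [SFinite (volume : Measure E)] [SFinite (volume : Measure F)]
    [(volume : Measure E).IsAddHaarMeasure] [(volume : Measure F).IsAddHaarMeasure] :
    (volume : Measure (E × F)).IsAddHaarMeasure :=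
  inferInstanceAs ((volume : Measure E).prod (volume : Measure F)).IsAddHaarMeasure

/-- A Schwartz function on `ℝ × V` decays in its first variable faster than any power. -/
theorem SchwartzMap.exists_norm_mul_one_add_pow_le {V F : Type*} [NormedAddCommGroup V]
    [NormedSpace ℝ V] [NormedAddCommGroup F] [NormedSpace ℝ F] (G : SchwartzMap (ℝ × V) F)
    (n : ℕ) :
    ∃ C : ℝ, ∀ s v, 0 ≤ s → (1 + s) ^ n * ‖G (s, v)‖ ≤ C := by
  refine ⟨_, fun s v hs => le_trans ?_ (SchwartzMap.one_add_le_sup_seminorm_apply (𝕜 := ℝ)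
    (m := (n, 0)) le_rfl le_rfl G (s, v))⟩
  rw [norm_iteratedFDeriv_zero]
  have : s ≤ ‖(s, v)‖ := (le_abs_self s).trans (norm_fst_le (s, v))
  gcongr

/-- The integrand of the squared norm is dominated by a product of integrable functions. -/
theorem exists_phi4_integrand_le (G : SchwartzMap (ℝ × V3) ℂ) :
    ∃ C : ℝ, ∀ a b c d : V3,
      (1 / ((2 * π) ^ 3 * (2 * ‖a‖))) * (1 / ((2 * π) ^ 3 * (2 * ‖b‖)))
            * (1 / ((2 * π) ^ 3 * (2 * ‖c‖))) * (1 / ((2 * π) ^ 3 * (2 * ‖d‖)))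
            * ‖G (‖a‖ + ‖b‖ + ‖c‖ + ‖d‖, a + b + c + d)‖ ^ 2 ≤
      C * ((‖a‖⁻¹ * ((1 + ‖a‖) ^ 4)⁻¹) * ((‖b‖⁻¹ * ((1 + ‖b‖) ^ 4)⁻¹) *
        ((‖c‖⁻¹ * ((1 + ‖c‖) ^ 4)⁻¹) * (‖d‖⁻¹ * ((1 + ‖d‖) ^ 4)⁻¹)))) := by
  obtain ⟨C, hC⟩ := G.exists_norm_mul_one_add_pow_le 8
  refine ⟨(1 / ((2 * π) ^ 3 * 2)) ^ 4 * C ^ 2, fun a b c d => ?_⟩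
  set s := ‖a‖ + ‖b‖ + ‖c‖ + ‖d‖ with hs
  have ha := norm_nonneg a
  have hb := norm_nonneg b
  have hc := norm_nonneg c
  have hd := norm_nonneg d
  have hs0 : 0 ≤ s := by positivity
  have hG := hC s (a + b + c + d) hs0
  set g := ‖G (s, a + b + c + d)‖
  have hg : 0 ≤ g := norm_nonneg _
  clear_value g
  have has : ‖a‖ ≤ s := by linarith
  have hbs : ‖b‖ ≤ s := by linarith
  have hcs : ‖c‖ ≤ s := by linarith
  have hds : ‖d‖ ≤ s := by linarith
  clear_value s
  have hP : (1 + ‖a‖) ^ 4 * (1 + ‖b‖) ^ 4 * (1 + ‖c‖) ^ 4 * (1 + ‖d‖) ^ 4 ≤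
      (1 + s) ^ 16 := by
    calc _ ≤ (1 + s) ^ 4 * (1 + s) ^ 4 * (1 + s) ^ 4 * (1 + s) ^ 4 := by
          gcongr
      _ = _ := by ring
  have hg2 : (1 + ‖a‖) ^ 4 * (1 + ‖b‖) ^ 4 * (1 + ‖c‖) ^ 4 * (1 + ‖d‖) ^ 4 * g ^ 2 ≤ C ^ 2 :=
    calc _ ≤ (1 + s) ^ 16 * g ^ 2 := by gcongr
      _ = ((1 + s) ^ 8 * g) ^ 2 := by ring
      _ ≤ C ^ 2 := by gcongr
  have hg3 : g ^ 2 ≤ C ^ 2 * (((1 + ‖a‖) ^ 4)⁻¹ * ((1 + ‖b‖) ^ 4)⁻¹ * ((1 + ‖c‖) ^ 4)⁻¹ *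
      ((1 + ‖d‖) ^ 4)⁻¹) := by
    rw [← mul_inv, ← mul_inv, ← mul_inv, ← div_eq_mul_inv, le_div_iff₀ (by positivity), mul_comm]
    exact hg2
  calc _ ≤ (1 / ((2 * π) ^ 3 * (2 * ‖a‖))) * (1 / ((2 * π) ^ 3 * (2 * ‖b‖)))
            * (1 / ((2 * π) ^ 3 * (2 * ‖c‖))) * (1 / ((2 * π) ^ 3 * (2 * ‖d‖))) *
          (C ^ 2 * (((1 + ‖a‖) ^ 4)⁻¹ * ((1 + ‖b‖) ^ 4)⁻¹ * ((1 + ‖c‖) ^ 4)⁻¹ *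
            ((1 + ‖d‖) ^ 4)⁻¹)) := by gcongr
    _ = _ := by
      simp only [one_div, mul_inv]
      ring

/-- **The squared L² norm of the first-order vacuum-decay amplitude in the massless `φ⁴`
model is independent of the adiabatic parameter `ε`, and finite.**  For a Schwartz function
`G` on `ℝ⁴ = ℝ × ℝ³` and every `ε > 0`,
`∫ ∏ᵢ d³k⃗ᵢ/((2π)³2|k⃗ᵢ|) ε^{−8} |G((Σ|k⃗ᵢ|)/ε, (Σk⃗ᵢ)/ε)|²
  = ∫ ∏ᵢ d³k⃗ᵢ/((2π)³2|k⃗ᵢ|) |G(Σ|k⃗ᵢ|, Σk⃗ᵢ)|²`, and both (equal, nonnegative) integrals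
are finite. -/
theorem phi4_vacuum_decay_L2_norm_eps_independent
    (G : SchwartzMap (ℝ × V3) ℂ) (ε : ℝ) (hε : 0 < ε) :
    (∫⁻ k : V3 × V3 × V3 × V3,
        ENNReal.ofReal (
          (1 / ((2 * π) ^ 3 * (2 * ‖k.1‖))) * (1 / ((2 * π) ^ 3 * (2 * ‖k.2.1‖)))
            * (1 / ((2 * π) ^ 3 * (2 * ‖k.2.2.1‖))) * (1 / ((2 * π) ^ 3 * (2 * ‖k.2.2.2‖)))
            * (ε ^ (-8 : ℤ))
            * ‖G ((‖k.1‖ + ‖k.2.1‖ + ‖k.2.2.1‖ + ‖k.2.2.2‖) / ε,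
                  ε⁻¹ • (k.1 + k.2.1 + k.2.2.1 + k.2.2.2))‖ ^ 2))
      =
      (∫⁻ k : V3 × V3 × V3 × V3,
        ENNReal.ofReal (
          (1 / ((2 * π) ^ 3 * (2 * ‖k.1‖))) * (1 / ((2 * π) ^ 3 * (2 * ‖k.2.1‖)))
            * (1 / ((2 * π) ^ 3 * (2 * ‖k.2.2.1‖))) * (1 / ((2 * π) ^ 3 * (2 * ‖k.2.2.2‖)))
            * ‖G (‖k.1‖ + ‖k.2.1‖ + ‖k.2.2.1‖ + ‖k.2.2.2‖,
                  k.1 + k.2.1 + k.2.2.1 + k.2.2.2)‖ ^ 2))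
    ∧
    (∫⁻ k : V3 × V3 × V3 × V3,
        ENNReal.ofReal (
          (1 / ((2 * π) ^ 3 * (2 * ‖k.1‖))) * (1 / ((2 * π) ^ 3 * (2 * ‖k.2.1‖)))
            * (1 / ((2 * π) ^ 3 * (2 * ‖k.2.2.1‖))) * (1 / ((2 * π) ^ 3 * (2 * ‖k.2.2.2‖)))
            * ‖G (‖k.1‖ + ‖k.2.1‖ + ‖k.2.2.1‖ + ‖k.2.2.2‖,
                  k.1 + k.2.1 + k.2.2.1 + k.2.2.2)‖ ^ 2)) ≠ ⊤ := by
  constructor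
  · have := isAddHaarMeasure_volume_prod V3 V3
    have := isAddHaarMeasure_volume_prod V3 (V3 × V3)
    have := isAddHaarMeasure_volume_prod V3 (V3 × V3 × V3)
    have hscale := lintegral_comp_inv_smul_addHaar (volume : Measure (V3 × V3 × V3 × V3))
      (fun k => ENNReal.ofReal (
          (1 / ((2 * π) ^ 3 * (2 * ‖k.1‖))) * (1 / ((2 * π) ^ 3 * (2 * ‖k.2.1‖)))
            * (1 / ((2 * π) ^ 3 * (2 * ‖k.2.2.1‖))) * (1 / ((2 * π) ^ 3 * (2 * ‖k.2.2.2‖)))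
            * ‖G (‖k.1‖ + ‖k.2.1‖ + ‖k.2.2.1‖ + ‖k.2.2.2‖,
                  k.1 + k.2.1 + k.2.2.1 + k.2.2.2)‖ ^ 2)) hε
    have hdim : Module.finrank ℝ (V3 × V3 × V3 × V3) = 12 := by
      simp [Module.finrank_prod]
    have hcancel : ENNReal.ofReal (ε⁻¹ ^ 12) * ENNReal.ofReal (ε ^ 12) = 1 := by
      rw [← ENNReal.ofReal_mul (by positivity), ← mul_pow, inv_mul_cancel₀ hε.ne', one_pow,
        ENNReal.ofReal_one]
    rw [hdim] at hscale
    symm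
    rw [← one_mul (∫⁻ k : V3 × V3 × V3 × V3, _), ← hcancel, mul_assoc, ← hscale,
      ← lintegral_const_mul' _ _ ENNReal.ofReal_ne_top]
    refine lintegral_congr fun k => ?_
    rw [← ENNReal.ofReal_mul (by positivity)]
    congr 1
    simp only [Prod.smul_fst, Prod.smul_snd, norm_smul, norm_inv, Real.norm_of_nonneg hε.le,
      ← smul_add, ← mul_add, div_eq_inv_mul, mul_inv, inv_inv, mul_one]
    rw [show ε ^ (-8 : ℤ) = ε⁻¹ ^ 8 by rw [zpow_neg, inv_pow]; norm_cast]
    field_simp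
  · obtain ⟨C, hC⟩ := exists_phi4_integrand_le G
    have hI := integrable_inv_norm_mul_one_add_norm_pow
    have hint := (hI.mul_prod (hI.mul_prod (hI.mul_prod hI))).const_mul C
    refine ne_top_of_le_ne_top hint.lintegral_lt_top.ne (lintegral_mono fun k => ?_)
    exact ENNReal.ofReal_le_ofReal (hC k.1 k.2.1 k.2.2.1 k.2.2.2)
end
end

section
/- Let η ∈ 𝓢(ℝ⁴, ℝ) and f ∈ 𝓢(ℝ³, ℂ). Then lim_{λ→∞} λ³ ∫_{ℝ³} d³u⃗/((2π)³ 2√(1+|u⃗|²)) · |f(u⃗)|² · ∫_ℝ dτ η( λ − τ√(1+|u⃗|²) , −τ u⃗ ) = (1/(2(2π)³)) |f(0)|² ∫_{ℝ⁴} η(x) dx. (This identifies the timelike asymptotic behavior of matrix elements of the asymptotic current J_as(η; λv) in the direction v = (1,0,0,0): it decays like λ^{−3} with the stated coefficient, the same rate and coefficient as the matrix elements of the interacting current.) -/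
open MeasureTheory Filter Topology Real

noncomputable section

/-- The integrand of the timelike matrix element after the substitutions `u = -w / lam` and
`s = lam - τ √(1 + |u|²)`, as a function of `(s, w)`. -/
def rescaledIntegrand (η : ℝ × V3 → ℝ) (f : V3 → ℂ) (lam : ℝ) (p : ℝ × V3) : ℝ :=
  (1 / ((2 * π) ^ 3 * (2 * Real.sqrt (1 + ‖(-lam⁻¹) • p.2‖ ^ 2)))) * ‖f ((-lam⁻¹) • p.2)‖ ^ 2 *
    ((Real.sqrt (1 + ‖(-lam⁻¹) • p.2‖ ^ 2))⁻¹ *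
      η (p.1, ((lam - p.1) / Real.sqrt (1 + ‖(-lam⁻¹) • p.2‖ ^ 2) * lam⁻¹) • p.2))

lemma one_le_sqrt_one_add_norm_sq (u : V3) : 1 ≤ Real.sqrt (1 + ‖u‖ ^ 2) :=
  Real.one_le_sqrt.mpr (by nlinarith [sq_nonneg ‖u‖])

lemma norm_le_sqrt_one_add_norm_sq (u : V3) : ‖u‖ ≤ Real.sqrt (1 + ‖u‖ ^ 2) :=
  Real.le_sqrt_of_sq_le (by linarith)

lemma integral_worldline_eq (η : ℝ × V3 → ℝ) (lam c : ℝ) (hc : 0 < c) (w : V3) :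
    ∫ τ : ℝ, η (lam - τ * c, (-τ) • ((-lam⁻¹) • w)) =
      ∫ s : ℝ, c⁻¹ * η (s, ((lam - s) / c * lam⁻¹) • w) := by
  rw [integral_const_mul, ← integral_sub_left_eq_self
    (fun s : ℝ => η (s, ((lam - s) / c * lam⁻¹) • w)) volume lam]
  have h := Measure.integral_comp_mul_right
    (fun t : ℝ => η (lam - t, ((lam - (lam - t)) / c * lam⁻¹) • w)) c
  rw [abs_of_pos (inv_pos.mpr hc), smul_eq_mul] at h
  rw [← h]
  refine integral_congr_ae (Eventually.of_forall fun τ => ?_)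
  have : (lam - (lam - τ * c)) / c * lam⁻¹ = -τ * -lam⁻¹ := by
    field_simp
    ring
  simp only [this, smul_smul]

lemma continuous_rescaledIntegrand {η : ℝ × V3 → ℝ} {f : V3 → ℂ} (hη : Continuous η)
    (hf : Continuous f) (lam : ℝ) : Continuous (rescaledIntegrand η f lam) := by
  have hne (u : V3) : Real.sqrt (1 + ‖u‖ ^ 2) ≠ 0 :=
    (zero_lt_one.trans_le (one_le_sqrt_one_add_norm_sq u)).ne'
  have hne' (u : V3) : (2 * π) ^ 3 * (2 * Real.sqrt (1 + ‖u‖ ^ 2)) ≠ 0 :=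
    mul_ne_zero (by positivity) (mul_ne_zero two_ne_zero (hne u))
  unfold rescaledIntegrand
  fun_prop (disch := intros; first | exact hne _ | exact hne' _)

/-- The elementary inequality behind the domination of `rescaledIntegrand`. -/
lemma one_add_norm_le_mul (lam s : ℝ) (hlam : lam ≠ 0) (w : V3) :
    1 + ‖w‖ ≤ Real.sqrt (1 + ‖(-lam⁻¹) • w‖ ^ 2) * ((1 + |s|) *
      (1 + ‖((lam - s) / Real.sqrt (1 + ‖(-lam⁻¹) • w‖ ^ 2) * lam⁻¹) • w‖)) := by
  have h1 := one_le_sqrt_one_add_norm_sq ((-lam⁻¹) • w)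
  have h2 := norm_le_sqrt_one_add_norm_sq ((-lam⁻¹) • w)
  set c := Real.sqrt (1 + ‖(-lam⁻¹) • w‖ ^ 2)
  have hc : 0 < c := by linarith
  set y := ((lam - s) / c * lam⁻¹) • w with hy
  have hw : w = c • y - s • ((-lam⁻¹) • w) := by
    rw [hy, smul_smul, smul_smul, ← sub_smul]
    have : c * ((lam - s) / c * lam⁻¹) - s * -lam⁻¹ = 1 := by
      field_simp
      ring
    rw [this, one_smul]
  have h3 : ‖w‖ ≤ c * ‖y‖ + |s| * c := by
    calc ‖w‖ = ‖c • y - s • ((-lam⁻¹) • w)‖ := congrArg _ hw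
      _ ≤ ‖c • y‖ + ‖s • ((-lam⁻¹) • w)‖ := norm_sub_le _ _
      _ = c * ‖y‖ + |s| * ‖(-lam⁻¹) • w‖ := by
        rw [norm_smul, norm_smul s, Real.norm_of_nonneg hc.le, Real.norm_eq_abs]
      _ ≤ c * ‖y‖ + |s| * c := by gcongr
  have h4 : 0 ≤ c * (|s| * ‖y‖) := by positivity
  nlinarith

lemma exists_one_add_norm_pow_mul_le {E F : Type*} [NormedAddCommGroup E] [NormedSpace ℝ E]
    [NormedAddCommGroup F] [NormedSpace ℝ F] (f : SchwartzMap E F) (k : ℕ) :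
    ∃ C, 0 ≤ C ∧ ∀ x, (1 + ‖x‖) ^ k * ‖f x‖ ≤ C := by
  have h (x : E) := SchwartzMap.one_add_le_sup_seminorm_apply (𝕜 := ℝ) (m := (k, 0))
    le_rfl le_rfl f x
  simp only [norm_iteratedFDeriv_zero] at h
  exact ⟨_, le_trans (by positivity) (h 0), h⟩

lemma exists_norm_rescaledIntegrand_le (η : SchwartzMap (ℝ × V3) ℝ) (f : SchwartzMap V3 ℂ) :
    ∃ C, ∀ lam : ℝ, lam ≠ 0 → ∀ p : ℝ × V3, ‖rescaledIntegrand η f lam p‖ ≤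
      C * ((1 + ‖p.1‖) ^ (-2 : ℝ) * (1 + ‖p.2‖) ^ (-4 : ℝ)) := by
  obtain ⟨A, hA, hfA⟩ := exists_one_add_norm_pow_mul_le f 2
  obtain ⟨B, hB, hηB⟩ := exists_one_add_norm_pow_mul_le η 10
  refine ⟨A ^ 2 * B, fun lam hlam ⟨s, w⟩ => ?_⟩
  have hkey := one_add_norm_le_mul lam s hlam w
  unfold rescaledIntegrand
  dsimp only at hkey ⊢
  set u := (-lam⁻¹) • w
  have h1 := one_le_sqrt_one_add_norm_sq u
  have hcu : Real.sqrt (1 + ‖u‖ ^ 2) ≤ 1 + ‖u‖ :=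
    Real.sqrt_le_iff.mpr ⟨by positivity, by nlinarith [norm_nonneg u]⟩
  set c := Real.sqrt (1 + ‖u‖ ^ 2)
  have hc : 0 < c := by linarith
  set y := ((lam - s) / c * lam⁻¹) • w
  have hf : c ^ 4 * ‖f u‖ ^ 2 ≤ A ^ 2 := by
    calc c ^ 4 * ‖f u‖ ^ 2 = (c ^ 2 * ‖f u‖) ^ 2 := by ring
      _ ≤ ((1 + ‖u‖) ^ 2 * ‖f u‖) ^ 2 := by gcongr
      _ ≤ A ^ 2 := by gcongr; exact hfA u
  have hη : (1 + |s|) ^ 6 * (1 + ‖y‖) ^ 4 * ‖η (s, y)‖ ≤ B := by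
    have hs : |s| ≤ ‖(s, y)‖ := norm_fst_le (s, y)
    have hy : ‖y‖ ≤ ‖(s, y)‖ := norm_snd_le (s, y)
    calc (1 + |s|) ^ 6 * (1 + ‖y‖) ^ 4 * ‖η (s, y)‖
        ≤ (1 + ‖(s, y)‖) ^ 6 * (1 + ‖(s, y)‖) ^ 4 * ‖η (s, y)‖ := by gcongr
      _ = (1 + ‖(s, y)‖) ^ 10 * ‖η (s, y)‖ := by ring
      _ ≤ B := hηB _
  have hpi : 1 / ((2 * π) ^ 3 * (2 * c)) ≤ 1 := by
    rw [div_le_one (by positivity)]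
    have : 1 ≤ (2 * π) ^ 3 := one_le_pow₀ (by linarith [Real.pi_gt_three])
    nlinarith
  have hcinv : c⁻¹ ≤ 1 := inv_le_one_of_one_le₀ h1
  have hrs : (1 + ‖s‖) ^ (-2 : ℝ) = ((1 + |s|) ^ 2)⁻¹ := by
    rw [Real.rpow_neg (by positivity), Real.norm_eq_abs]; norm_cast
  have hrw : (1 + ‖w‖) ^ (-4 : ℝ) = ((1 + ‖w‖) ^ 4)⁻¹ := by
    rw [Real.rpow_neg (by positivity)]; norm_cast
  have hbound : ‖f u‖ ^ 2 * ‖η (s, y)‖ * ((1 + |s|) ^ 2 * (1 + ‖w‖) ^ 4) ≤ A ^ 2 * B := by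
    calc ‖f u‖ ^ 2 * ‖η (s, y)‖ * ((1 + |s|) ^ 2 * (1 + ‖w‖) ^ 4)
        ≤ ‖f u‖ ^ 2 * ‖η (s, y)‖ *
          ((1 + |s|) ^ 2 * (c * ((1 + |s|) * (1 + ‖y‖))) ^ 4) := by gcongr
      _ = (c ^ 4 * ‖f u‖ ^ 2) * ((1 + |s|) ^ 6 * (1 + ‖y‖) ^ 4 * ‖η (s, y)‖) := by ring
      _ ≤ A ^ 2 * B := by gcongr
  rw [hrs, hrw, ← mul_inv, ← div_eq_mul_inv, le_div_iff₀ (by positivity)]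
  refine le_trans ?_ hbound
  refine mul_le_mul_of_nonneg_right ?_ (by positivity)
  rw [norm_mul, norm_mul, norm_mul, Real.norm_of_nonneg (by positivity),
    Real.norm_of_nonneg (by positivity), Real.norm_of_nonneg (by positivity)]
  calc 1 / ((2 * π) ^ 3 * (2 * c)) * ‖f u‖ ^ 2 * (c⁻¹ * ‖η (s, y)‖)
      ≤ 1 * ‖f u‖ ^ 2 * (1 * ‖η (s, y)‖) := by gcongr
    _ = ‖f u‖ ^ 2 * ‖η (s, y)‖ := by ring

lemma integrable_one_add_norm_prod :
    Integrable fun p : ℝ × V3 => (1 + ‖p.1‖) ^ (-2 : ℝ) * (1 + ‖p.2‖) ^ (-4 : ℝ) :=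
  Integrable.mul_prod (f := fun s : ℝ => (1 + ‖s‖) ^ (-2 : ℝ))
    (g := fun w : V3 => (1 + ‖w‖) ^ (-4 : ℝ))
    (integrable_one_add_norm (by norm_num)) (integrable_one_add_norm (by norm_num))

lemma integrable_rescaledIntegrand (η : SchwartzMap (ℝ × V3) ℝ) (f : SchwartzMap V3 ℂ)
    {lam : ℝ} (hlam : lam ≠ 0) : Integrable (rescaledIntegrand η f lam) := by
  obtain ⟨C, hC⟩ := exists_norm_rescaledIntegrand_le η f
  exact (integrable_one_add_norm_prod.const_mul C).mono'
    (continuous_rescaledIntegrand η.continuous f.continuous lam).aestronglyMeasurable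
    (Eventually.of_forall (hC lam hlam))

lemma matrixElement_eq_integral_rescaledIntegrand (η : SchwartzMap (ℝ × V3) ℝ)
    (f : SchwartzMap V3 ℂ) {lam : ℝ} (hlam : 0 < lam) :
    lam ^ 3 * ∫ u : V3, (1 / ((2 * π) ^ 3 * (2 * Real.sqrt (1 + ‖u‖ ^ 2)))) * ‖f u‖ ^ 2 *
        ∫ τ : ℝ, η (lam - τ * Real.sqrt (1 + ‖u‖ ^ 2), (-τ) • u) =
      ∫ p, rescaledIntegrand η f lam p := by
  have h := Measure.integral_comp_smul (volume : Measure V3)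
    (fun u : V3 => (1 / ((2 * π) ^ 3 * (2 * Real.sqrt (1 + ‖u‖ ^ 2)))) * ‖f u‖ ^ 2 *
        ∫ τ : ℝ, η (lam - τ * Real.sqrt (1 + ‖u‖ ^ 2), (-τ) • u)) (-lam⁻¹)
  have habs : |((-lam⁻¹) ^ Module.finrank ℝ V3)⁻¹| = lam ^ 3 := by
    rw [finrank_euclideanSpace_fin, abs_inv, abs_pow, abs_neg, abs_inv, abs_of_pos hlam,
      inv_pow, inv_inv]
  rw [habs, smul_eq_mul] at h
  rw [← h, Measure.volume_eq_prod,
    integral_prod_symm _ (integrable_rescaledIntegrand η f hlam.ne')]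
  refine integral_congr_ae (Eventually.of_forall fun w => ?_)
  simp only [rescaledIntegrand]
  rw [integral_const_mul, integral_worldline_eq η lam _
    (zero_lt_one.trans_le (one_le_sqrt_one_add_norm_sq _)) w]

lemma tendsto_rescaledIntegrand {η : ℝ × V3 → ℝ} {f : V3 → ℂ} (hη : Continuous η)
    (hf : Continuous f) (p : ℝ × V3) :
    Tendsto (fun lam => rescaledIntegrand η f lam p) atTop
      (𝓝 ((1 / (2 * (2 * π) ^ 3)) * ‖f 0‖ ^ 2 * η p)) := by
  obtain ⟨s, w⟩ := p
  have hinv : Tendsto (fun lam : ℝ => lam⁻¹) atTop (𝓝 0) := tendsto_inv_atTop_zero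
  have hu : Tendsto (fun lam : ℝ => (-lam⁻¹) • w) atTop (𝓝 0) := by
    simpa using hinv.neg.smul_const w
  have hc : Tendsto (fun lam : ℝ => Real.sqrt (1 + ‖(-lam⁻¹) • w‖ ^ 2)) atTop (𝓝 1) := by
    simpa using ((hu.norm.pow 2).const_add 1).sqrt
  have hy : Tendsto (fun lam : ℝ =>
      ((lam - s) / Real.sqrt (1 + ‖(-lam⁻¹) • w‖ ^ 2) * lam⁻¹) • w) atTop (𝓝 w) := by
    have h1 : Tendsto (fun lam : ℝ => (1 - s * lam⁻¹) / Real.sqrt (1 + ‖(-lam⁻¹) • w‖ ^ 2))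
        atTop (𝓝 1) := by
      have h := ((hinv.const_mul s).const_sub 1).div hc one_ne_zero
      rwa [mul_zero, sub_zero, div_one] at h
    have h2 := h1.smul_const w
    rw [one_smul] at h2
    refine h2.congr' ?_
    filter_upwards [eventually_ne_atTop 0] with lam hlam
    congr 1
    field_simp
  have hηlim := (hη.tendsto (s, w)).comp (tendsto_const_nhds.prodMk_nhds hy)
  have hflim := ((hf.tendsto 0).comp hu).norm.pow 2
  have hpre := (tendsto_const_nhds (x := (1 : ℝ))).div
    ((hc.const_mul 2).const_mul ((2 * π) ^ 3)) (by positivity)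
  have := (hpre.mul hflim).mul ((hc.inv₀ one_ne_zero).mul hηlim)
  rwa [mul_one, inv_one, one_mul, mul_comm _ (2 : ℝ)] at this

/-- **Timelike asymptotics of the one-electron matrix element of the asymptotic current**
in the direction `v = (1,0,0,0)`: for `η ∈ 𝓢(ℝ⁴,ℝ)` and `f ∈ 𝓢(ℝ³,ℂ)`,
`λ³ ∫ d³u⃗/((2π)³ 2√(1+|u⃗|²)) |f(u⃗)|² ∫_ℝ dτ η(λ − τ√(1+|u⃗|²), −τu⃗)`
tends to `(1/(2(2π)³)) |f(0)|² ∫_{ℝ⁴} η(x) dx` as `λ → ∞`. -/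
theorem asymptotic_current_timelike_decay
    (η : SchwartzMap (ℝ × V3) ℝ) (f : SchwartzMap V3 ℂ) :
    Tendsto (fun lam : ℝ =>
        lam ^ 3 *
          ∫ u : V3,
            (1 / ((2 * π) ^ 3 * (2 * Real.sqrt (1 + ‖u‖ ^ 2)))) * ‖f u‖ ^ 2 *
              ∫ τ : ℝ, η (lam - τ * Real.sqrt (1 + ‖u‖ ^ 2), (-τ) • u))
      atTop
      (𝓝 ((1 / (2 * (2 * π) ^ 3)) * ‖f 0‖ ^ 2 * ∫ x : ℝ × V3, η x)) := by
  obtain ⟨C, hC⟩ := exists_norm_rescaledIntegrand_le η f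
  rw [← integral_const_mul]
  have hlim : Tendsto (fun lam : ℝ => ∫ p, rescaledIntegrand η f lam p) atTop
      (𝓝 (∫ p, (1 / (2 * (2 * π) ^ 3)) * ‖f 0‖ ^ 2 * η p)) := by
    refine tendsto_integral_filter_of_dominated_convergence _ ?_ ?_
      (integrable_one_add_norm_prod.const_mul C) ?_
    · exact Eventually.of_forall fun lam =>
        (continuous_rescaledIntegrand η.continuous f.continuous lam).aestronglyMeasurable
    · filter_upwards [eventually_ne_atTop 0] with lam hlam
      exact Eventually.of_forall (hC lam hlam)
    · exact Eventually.of_forall (tendsto_rescaledIntegrand η.continuous f.continuous)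
  refine hlim.congr' ?_
  filter_upwards [eventually_gt_atTop 0] with lam hlam
  exact (matrixElement_eq_integral_rescaledIntegrand η f hlam).symm
end
end

section
/- Let m > 0 and c₁, c₂ ∈ ℝ, and define Ξ : (−m², ∞) → ℝ by Ξ(s) := (1/(16π²)) · (s/(s+m²)) · log(|s|/m²) + c₁ + c₂ s for s ≠ 0, and Ξ(0) := c₁ (the continuous extension). Then for all a, b, c ∈ ℝ and every δ ∈ (0, 2), the function ε ↦ Ξ(−2εa + ε²b) + Ξ(2εa − ε²c) − 2c₁ (defined for all sufficiently small ε > 0) is O(ε^{2−δ}) as ε → 0⁺; i.e. there exist C > 0 and ε₀ > 0 such that |Ξ(−2εa + ε²b) + Ξ(2εa − ε²c) − 2c₁| ≤ C ε^{2−δ} for all ε ∈ (0, ε₀). -/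
open Real

noncomputable section

/-- The second-order electron self-energy correction in the scalar model, as a function of
`s = q² − m²`: `Ξ(s) = (1/16π²)(s/(s+m²)) log(|s|/m²) + c₁ + c₂ s` for `s ≠ 0`, with the
continuous extension `Ξ(0) = c₁`. -/
def Xi (m c₁ c₂ : ℝ) (s : ℝ) : ℝ :=
  if s = 0 then c₁
  else (1 / (16 * π ^ 2)) * (s / (s + m ^ 2)) * Real.log (|s| / m ^ 2) + c₁ + c₂ * s

open Filter Topology Asymptotics

lemma Xi_sub_eq (m c₁ c₂ s : ℝ) :
    Xi m c₁ c₂ s - c₁ =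
      (1 / (16 * π ^ 2)) * (s / (s + m ^ 2)) * Real.log (|s| / m ^ 2) + c₂ * s := by
  unfold Xi
  split_ifs with h
  · simp [h]
  · ring

/-- The function `x ↦ x log (|x| / m²)`, in a form that is manifestly continuous. -/
def scaledLog (m x : ℝ) : ℝ := x * Real.log x - x * Real.log (m ^ 2)

lemma scaledLog_neg (m x : ℝ) : scaledLog m (-x) = -scaledLog m x := by
  simp only [scaledLog, Real.log_neg_eq_log]
  ring

lemma scaledLog_mul (m x : ℝ) {ε : ℝ} (hε : 0 < ε) :
    scaledLog m (ε * x) = ε * (x * Real.log ε + scaledLog m x) := by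
  rcases eq_or_ne x 0 with rfl | hx
  · simp [scaledLog]
  · simp only [scaledLog, Real.log_mul hε.ne' hx]
    ring

lemma mul_log_abs_div (m x : ℝ) (hm : 0 < m) :
    x * Real.log (|x| / m ^ 2) = scaledLog m x := by
  rcases eq_or_ne x 0 with rfl | hx
  · simp [scaledLog]
  · rw [Real.log_div (abs_ne_zero.mpr hx) (by positivity), Real.log_abs, scaledLog]
    ring

lemma Xi_mul_sub_eq (m c₁ c₂ x : ℝ) (hm : 0 < m) {ε : ℝ} (hε : 0 < ε) :
    Xi m c₁ c₂ (ε * x) - c₁ =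
      (1 / (16 * π ^ 2)) * (ε * Real.log ε * (x / (ε * x + m ^ 2))
        + ε * (scaledLog m x / (ε * x + m ^ 2))) + c₂ * (ε * x) := by
  have h := mul_log_abs_div m (ε * x) hm
  rw [scaledLog_mul m x hε] at h
  rw [Xi_sub_eq]
  calc _ = (1 / (16 * π ^ 2)) * ((ε * x * Real.log (|ε * x| / m ^ 2)) / (ε * x + m ^ 2))
        + c₂ * (ε * x) := by ring
    _ = _ := by rw [h]; ring

lemma isBigO_id_of_differentiableAt {f : ℝ → ℝ} (hf : DifferentiableAt ℝ f 0) (h0 : f 0 = 0) :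
    f =O[𝓝[>] 0] (fun ε : ℝ => ε) := by
  simpa [h0] using hf.isBigO_sub.mono (nhdsWithin_le_nhds (s := Set.Ioi (0 : ℝ)))

lemma one_isBigO_rpow_neg {δ : ℝ} (hδ : 0 < δ) :
    (fun _ : ℝ => (1 : ℝ)) =O[𝓝[>] 0] (fun ε : ℝ => ε ^ (-δ)) := by
  refine IsBigO.of_bound 1 ?_
  filter_upwards [Ioo_mem_nhdsGT (zero_lt_one' ℝ)] with ε hε
  have h := Real.one_le_rpow_of_pos_of_le_one_of_nonpos hε.1 hε.2.le (neg_nonpos.mpr hδ.le)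
  rw [norm_one, one_mul]
  exact h.trans (le_abs_self _)

lemma log_isBigO_rpow_neg {δ : ℝ} (hδ : 0 < δ) :
    Real.log =O[𝓝[>] 0] (fun ε : ℝ => ε ^ (-δ)) :=
  (isLittleO_log_rpow_nhdsGT_zero (neg_lt_zero.mpr hδ)).isBigO

lemma rational_bracket_differentiableAt (m a b : ℝ) (hm : 0 < m) :
    DifferentiableAt ℝ (fun ε : ℝ => (a + ε * b) / (ε * (a + ε * b) + m ^ 2)) 0 := by
  have h : (0 : ℝ) * (a + 0 * b) + m ^ 2 ≠ 0 := by simp [hm.ne']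
  fun_prop (disch := assumption)

lemma scaledLog_bracket_differentiableAt (m a b : ℝ) (hm : 0 < m) (ha : a ≠ 0) :
    DifferentiableAt ℝ
      (fun ε : ℝ => scaledLog m (a + ε * b) / (ε * (a + ε * b) + m ^ 2)) 0 := by
  have h : (0 : ℝ) * (a + 0 * b) + m ^ 2 ≠ 0 := by simp [hm.ne']
  have h' : a + 0 * b ≠ 0 := by simpa using ha
  unfold scaledLog
  fun_prop (disch := assumption)

lemma scaledLog_bracket_isBigO (m b δ : ℝ) (hm : 0 < m) (hδ : 0 < δ) :
    (fun ε : ℝ => scaledLog m (ε * b) / (ε * (ε * b) + m ^ 2))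
      =O[𝓝[>] 0] (fun ε : ℝ => ε * ε ^ (-δ)) := by
  have hden : (fun ε : ℝ => (ε * (ε * b) + m ^ 2)⁻¹) =O[𝓝[>] 0] (fun _ => (1 : ℝ)) := by
    have hc : ContinuousAt (fun ε : ℝ => (ε * (ε * b) + m ^ 2)⁻¹) 0 :=
      ContinuousAt.inv₀ (by fun_prop) (by simp [hm.ne'])
    exact (hc.tendsto.mono_left nhdsWithin_le_nhds).isBigO_one ℝ
  have hlog : (fun ε : ℝ => b * Real.log ε + scaledLog m b) =O[𝓝[>] 0]
      (fun ε : ℝ => ε ^ (-δ)) := by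
    have h1 := (one_isBigO_rpow_neg hδ).const_mul_left (scaledLog m b)
    simp only [mul_one] at h1
    exact ((log_isBigO_rpow_neg hδ).const_mul_left b).add h1
  refine ((((isBigO_refl (fun ε : ℝ => ε) _).mul hlog).mul hden).congr' ?_ ?_)
  · filter_upwards [self_mem_nhdsWithin] with ε hε
    rw [scaledLog_mul m b hε, div_eq_mul_inv]
  · exact Eventually.of_forall fun ε => by simp

lemma scaledLog_brackets_isBigO (m a b c δ : ℝ) (hm : 0 < m) (hδ : 0 < δ) :
    (fun ε : ℝ => scaledLog m (a + ε * b) / (ε * (a + ε * b) + m ^ 2)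
        + scaledLog m (-a + ε * c) / (ε * (-a + ε * c) + m ^ 2))
      =O[𝓝[>] 0] (fun ε : ℝ => ε * ε ^ (-δ)) := by
  rcases eq_or_ne a 0 with rfl | ha
  · simp only [neg_zero, zero_add]
    exact (scaledLog_bracket_isBigO m b δ hm hδ).add (scaledLog_bracket_isBigO m c δ hm hδ)
  · have h := isBigO_id_of_differentiableAt
      ((scaledLog_bracket_differentiableAt m a b hm ha).add
        (scaledLog_bracket_differentiableAt m (-a) c hm (neg_ne_zero.mpr ha)))
      (by simp [scaledLog_neg, neg_div])
    have h1 := h.mul (one_isBigO_rpow_neg hδ)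
    simpa using h1

lemma Xi_add_Xi_isBigO (m c₁ c₂ a b c δ : ℝ) (hm : 0 < m) (hδ : 0 < δ) :
    (fun ε : ℝ => Xi m c₁ c₂ (ε * (a + ε * b)) + Xi m c₁ c₂ (ε * (-a + ε * c)) - 2 * c₁)
      =O[𝓝[>] 0] (fun ε : ℝ => ε ^ ((2 : ℝ) - δ)) := by
  have hid := isBigO_refl (fun ε : ℝ => ε) (𝓝[>] 0)
  have hrat := isBigO_id_of_differentiableAt
    ((rational_bracket_differentiableAt m a b hm).add
      (rational_bracket_differentiableAt m (-a) c hm)) (by simp [neg_div])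
  have hlin := (((hid.mul hid).mul (one_isBigO_rpow_neg hδ)).const_mul_left (c₂ * (b + c)))
  have hmain := (((hid.mul (log_isBigO_rpow_neg hδ)).mul hrat).congr_right
    (g₂ := fun ε : ℝ => ε * ε * ε ^ (-δ)) fun ε => by ring)
  have hrem := ((hid.mul (scaledLog_brackets_isBigO m a b c δ hm hδ)).congr_right
    (g₂ := fun ε : ℝ => ε * ε * ε ^ (-δ)) fun ε => by ring)
  refine ((((hmain.add hrem).const_mul_left (1 / (16 * π ^ 2))).add hlin).congr' ?_ ?_)
  · filter_upwards [self_mem_nhdsWithin] with ε hε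
    have h1 := Xi_mul_sub_eq m c₁ c₂ (a + ε * b) hm hε
    have h2 := Xi_mul_sub_eq m c₁ c₂ (-a + ε * c) hm hε
    simp only [Pi.add_apply]
    linear_combination -h1 - h2
  · filter_upwards [self_mem_nhdsWithin] with ε hε
    rw [sub_eq_add_neg, Real.rpow_add hε, Real.rpow_two, sq]

/-- **Symmetric cancellation of the self-energy corrections.**  For all `a b c : ℝ` and every
`δ ∈ (0,2)`, the quantity `Ξ(−2εa + ε²b) + Ξ(2εa − ε²c) − 2c₁` is `O(ε^{2−δ})` as `ε → 0⁺`: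
there are `C > 0` and `ε₀ > 0` with
`|Ξ(−2εa+ε²b) + Ξ(2εa−ε²c) − 2c₁| ≤ C ε^{2−δ}` for all `ε ∈ (0, ε₀)`. -/
theorem selfEnergy_symmetric_cancellation
    (m c₁ c₂ : ℝ) (hm : 0 < m) (a b c : ℝ) (δ : ℝ) (hδ0 : 0 < δ) (hδ2 : δ < 2) :
    ∃ C > (0 : ℝ), ∃ ε₀ > (0 : ℝ), ∀ ε : ℝ, 0 < ε → ε < ε₀ →
      |Xi m c₁ c₂ (-2 * ε * a + ε ^ 2 * b) + Xi m c₁ c₂ (2 * ε * a - ε ^ 2 * c) - 2 * c₁|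
        ≤ C * ε ^ ((2 : ℝ) - δ) := by
  obtain ⟨C, hC, hbound⟩ := (Xi_add_Xi_isBigO m c₁ c₂ (-2 * a) b (-c) δ hm hδ0).exists_pos
  obtain ⟨ε₀, hε₀, hsub⟩ := mem_nhdsGT_iff_exists_Ioo_subset.mp hbound.bound
  refine ⟨C, hC, ε₀, hε₀, fun ε hε hlt => ?_⟩
  have h := hsub ⟨hε, hlt⟩
  simp only [Set.mem_ofPred_eq, Real.norm_eq_abs, abs_of_pos (Real.rpow_pos_of_pos hε _)] at h
  convert h using 5 <;> ring_nf
end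
end

section
/- Let n ≥ 1, let G ∈ 𝓢(ℝ⁴, ℂ) be a Schwartz function, and let χ : ℝ^{4n} → ℂ be a smooth function, all of whose derivatives are bounded, such that χ ≡ 1 on some neighborhood of the origin. For ε ∈ (0,1] define h_ε : ℝ^{4n} → ℂ by h_ε(q₁, …, q_n) := (1 − χ(q₁,…,q_n)) · ∏_{i=1}^n G(qᵢ/ε), where each qᵢ ∈ ℝ⁴. Then h_ε ∈ 𝓢(ℝ^{4n}) for every ε, and for every M ∈ ℕ and all multi-indices α, β on ℝ^{4n} there is a constant C such that sup_{q ∈ ℝ^{4n}} |q^α ∂^β h_ε(q)| ≤ C ε^M for all ε ∈ (0,1]. In particular, for every M, ε^{−M} h_ε → 0 in the topology of 𝓢(ℝ^{4n}) as ε → 0⁺. -/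
open MeasureTheory Filter Topology
open scoped ContDiff

noncomputable section

/-- Four-dimensional Euclidean space `ℝ⁴`. -/
abbrev V4 : Type := EuclideanSpace ℝ (Fin 4)

/-- The tensor power `q ↦ ∏ᵢ G(qᵢ)` of a Schwartz function is a Schwartz function. -/
theorem SchwartzMap.exists_eq_prod_apply {ι E : Type*} [Fintype ι] [NormedAddCommGroup E]
    [NormedSpace ℝ E] (G : SchwartzMap E ℂ) :
    ∃ P : SchwartzMap (ι → E) ℂ, ∀ q, P q = ∏ i, G (q i) := by
  classical
  have hG (i : ι) : ContDiff ℝ ∞ (fun q : ι → E => G (q i)) :=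
    (G.smooth ⊤).comp (contDiff_apply ℝ E i)
  refine ⟨⟨fun q => ∏ i, G (q i), contDiff_prod fun i _ => hG i, fun k m => ?_⟩, fun q => rfl⟩
  choose C hC using fun j : ℕ => show ∃ C : ℝ, ∀ x,
      (1 + ‖x‖) ^ k * ‖iteratedFDeriv ℝ j G x‖ ≤ C from
    ⟨_, SchwartzMap.one_add_le_sup_seminorm_apply (𝕜 := ℝ) (m := (k, j)) le_rfl le_rfl G⟩
  have hderiv (i : ι) (j : ℕ) (q : ι → E) :
      ‖iteratedFDeriv ℝ j (fun q : ι → E => G (q i)) q‖ ≤ ‖iteratedFDeriv ℝ j G (q i)‖ := by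
    have hproj : ‖(ContinuousLinearMap.proj i : (ι → E) →L[ℝ] E)‖ ≤ 1 :=
      ContinuousLinearMap.opNorm_le_bound _ zero_le_one fun q => by
        simpa using norm_le_pi_norm q i
    have hcomp := (ContinuousLinearMap.proj i : (ι → E) →L[ℝ] E).iteratedFDeriv_comp_right
      (G.smooth ⊤) q (i := j) (mod_cast le_top)
    change ‖iteratedFDeriv ℝ j (G ∘ (ContinuousLinearMap.proj i : (ι → E) →L[ℝ] E)) q‖ ≤ _
    rw [hcomp]
    refine (ContinuousMultilinearMap.norm_compContinuousLinearMap_le _ _).trans ?_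
    refine mul_le_of_le_one_right (norm_nonneg _) ?_
    exact Finset.prod_le_one (fun _ _ => norm_nonneg _) fun _ _ => hproj
  have hnorm (q : ι → E) : ‖q‖ ≤ ∏ i, (1 + ‖q i‖) := by
    have hone (i : ι) : 1 ≤ 1 + ‖q i‖ := le_add_of_nonneg_right (norm_nonneg _)
    refine (pi_norm_le_iff_of_nonneg (Finset.prod_nonneg fun i _ => by positivity)).2 fun i => ?_
    calc ‖q i‖ ≤ 1 + ‖q i‖ := by simp
      _ ≤ ∏ i, (1 + ‖q i‖) := by
        rw [← Finset.mul_prod_erase _ _ (Finset.mem_univ i)]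
        exact le_mul_of_one_le_right (by positivity) (Finset.one_le_prod fun j _ => hone j)
  refine ⟨∑ p ∈ (Finset.univ : Finset ι).sym m, (p : Multiset ι).countPerms *
    ∏ i, C ((p : Multiset ι).count i), fun q => ?_⟩
  calc ‖q‖ ^ k * ‖iteratedFDeriv ℝ m (fun q : ι → E => ∏ i, G (q i)) q‖
      ≤ (∏ i, (1 + ‖q i‖)) ^ k * ∑ p ∈ (Finset.univ : Finset ι).sym m, (p : Multiset ι).countPerms *
        ∏ i, ‖iteratedFDeriv ℝ ((p : Multiset ι).count i) G (q i)‖ := by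
        gcongr
        · exact hnorm q
        · refine (norm_iteratedFDeriv_prod_le (fun i _ => hG i) (mod_cast le_top)).trans ?_
          gcongr
          exact hderiv _ _ _
    _ = ∑ p ∈ (Finset.univ : Finset ι).sym m, (p : Multiset ι).countPerms *
        ∏ i, ((1 + ‖q i‖) ^ k * ‖iteratedFDeriv ℝ ((p : Multiset ι).count i) G (q i)‖) := by
        simp_rw [Finset.mul_sum, Finset.prod_mul_distrib, Finset.prod_pow]
        exact Finset.sum_congr rfl fun p _ => by ring
    _ ≤ _ := by
        gcongr
        exact hC _ _

/-- Away from the origin, the derivatives of `q ↦ f (ε⁻¹ q)` vanish to all orders in `ε`,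
uniformly and with polynomial weights. -/
theorem SchwartzMap.exists_bound_iteratedFDeriv_comp_inv_smul {E F : Type*}
    [NormedAddCommGroup E] [NormedSpace ℝ E] [NormedAddCommGroup F] [NormedSpace ℝ F]
    (f : SchwartzMap E F) {r : ℝ} (hr : 0 < r) (k m M : ℕ) :
    ∃ C : ℝ, ∀ ε ∈ Set.Ioc (0 : ℝ) 1, ∀ q : E, r ≤ ‖q‖ →
      ‖q‖ ^ k * ‖iteratedFDeriv ℝ m (fun q => f (ε⁻¹ • q)) q‖ ≤ C * ε ^ M := by
  obtain ⟨S, hS, hf⟩ := f.decay (k + (m + M)) m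
  refine ⟨S / r ^ (m + M), fun ε ⟨hε, hε1⟩ q hq => ?_⟩
  rw [iteratedFDeriv_comp_const_smul _ (f.smooth m), norm_smul, norm_pow, norm_inv,
    Real.norm_of_nonneg hε.le, div_mul_eq_mul_div, le_div_iff₀ (by positivity)]
  set D := ‖iteratedFDeriv ℝ m f (ε⁻¹ • q)‖ with hD
  have hqx : ‖q‖ = ε * ‖ε⁻¹ • q‖ := by
    rw [norm_smul, norm_inv, Real.norm_of_nonneg hε.le, mul_inv_cancel_left₀ hε.ne']
  have hx := hf (ε⁻¹ • q)
  rw [← hD] at hx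
  calc ‖q‖ ^ k * (ε⁻¹ ^ m * D) * r ^ (m + M)
      ≤ ‖q‖ ^ k * (ε⁻¹ ^ m * D) * ‖q‖ ^ (m + M) := by gcongr
    _ = ε ^ k * ε ^ M * (‖ε⁻¹ • q‖ ^ (k + (m + M)) * D) := by
        rw [hqx]
        generalize ‖ε⁻¹ • q‖ = x
        have hεm : ε ^ m * ε⁻¹ ^ m = 1 := by
          rw [← mul_pow, mul_inv_cancel₀ hε.ne', one_pow]
        linear_combination ε ^ k * ε ^ M * x ^ (k + (m + M)) * D * hεm
    _ ≤ 1 * ε ^ M * S := by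
        gcongr
        exact pow_le_one₀ hε.le hε1
    _ = S * ε ^ M := by ring

/-- Multiplying by a function `ψ` with bounded derivatives that vanishes near the origin makes
the rescalings of a Schwartz function vanish rapidly, in every Schwartz seminorm. -/
theorem SchwartzMap.exists_bound_mul_comp_inv_smul {E : Type*} [NormedAddCommGroup E]
    [NormedSpace ℝ E] (f : SchwartzMap E ℂ) {ψ : E → ℂ} (hψ : ContDiff ℝ ∞ ψ)
    (hψ_bdd : ∀ i : ℕ, ∃ C : ℝ, ∀ x, ‖iteratedFDeriv ℝ i ψ x‖ ≤ C)
    (hψ_zero : ψ =ᶠ[𝓝 0] 0) (k i M : ℕ) :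
    ∃ C : ℝ, ∀ ε ∈ Set.Ioc (0 : ℝ) 1, ∀ q : E,
      ‖q‖ ^ k * ‖iteratedFDeriv ℝ i (fun q => ψ q * f (ε⁻¹ • q)) q‖ ≤ C * ε ^ M := by
  obtain ⟨r, hr, hball⟩ := Metric.eventually_nhds_iff_ball.1 hψ_zero.eventuallyEq_nhds
  choose A hA using hψ_bdd
  choose B hB using fun m => f.exists_bound_iteratedFDeriv_comp_inv_smul hr k m M
  have hA0 (j : ℕ) : 0 ≤ A j := (norm_nonneg _).trans (hA j 0)
  refine ⟨max 0 (∑ j ∈ Finset.range (i + 1), (i.choose j : ℝ) * A j * B (i - j)),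
    fun ε hε q => ?_⟩
  have hε0 : 0 < ε := hε.1
  rcases lt_or_ge ‖q‖ r with hq | hq
  · have hloc : (fun q => ψ q * f (ε⁻¹ • q)) =ᶠ[𝓝 q] fun _ => 0 := by
      filter_upwards [hball q (by simpa using hq)] with y hy
      simp [hy]
    rw [(hloc.iteratedFDeriv ℝ i).eq_of_nhds]
    have hz : iteratedFDeriv ℝ i (fun _ : E => (0 : ℂ)) q = 0 := by
      simp [iteratedFDeriv_fun_zero]
    rw [hz, norm_zero, mul_zero]
    positivity
  · have hf : ContDiff ℝ ∞ (fun q => f (ε⁻¹ • q)) :=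
      (f.smooth ⊤).comp (contDiff_const_smul ε⁻¹)
    calc ‖q‖ ^ k * ‖iteratedFDeriv ℝ i (fun q => ψ q * f (ε⁻¹ • q)) q‖
        ≤ ‖q‖ ^ k * ∑ j ∈ Finset.range (i + 1), (i.choose j : ℝ) * ‖iteratedFDeriv ℝ j ψ q‖ *
          ‖iteratedFDeriv ℝ (i - j) (fun q => f (ε⁻¹ • q)) q‖ := by
          gcongr
          exact norm_iteratedFDeriv_mul_le hψ hf q (mod_cast le_top)
      _ = ∑ j ∈ Finset.range (i + 1), (i.choose j : ℝ) * ‖iteratedFDeriv ℝ j ψ q‖ *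
          (‖q‖ ^ k * ‖iteratedFDeriv ℝ (i - j) (fun q => f (ε⁻¹ • q)) q‖) := by
          rw [Finset.mul_sum]
          exact Finset.sum_congr rfl fun j _ => by ring
      _ ≤ ∑ j ∈ Finset.range (i + 1), (i.choose j : ℝ) * A j * (B (i - j) * ε ^ M) := by
          refine Finset.sum_le_sum fun j _ => mul_le_mul ?_ (hB _ ε hε q hq) (by positivity)
            (mul_nonneg (Nat.cast_nonneg _) (hA0 j))
          gcongr
          exact hA j q
      _ = (∑ j ∈ Finset.range (i + 1), (i.choose j : ℝ) * A j * B (i - j)) * ε ^ M := by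
          rw [Finset.sum_mul]
          exact Finset.sum_congr rfl fun j _ => by ring
      _ ≤ _ := by
          gcongr
          exact le_max_right _ _

/-- A family of Schwartz functions all of whose seminorms are `O(ε ^ M)` for every `M` tends to
`0` in the Schwartz topology faster than any power of `ε`. -/
theorem SchwartzMap.tendsto_inv_pow_smul_of_bound {E F : Type*} [NormedAddCommGroup E]
    [NormedSpace ℝ E] [NormedAddCommGroup F] [NormedSpace ℝ F] {H : ℝ → SchwartzMap E F}
    (hH : ∀ k i M : ℕ, ∃ C : ℝ, ∀ ε ∈ Set.Ioc (0 : ℝ) 1, ∀ q : E,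
      ‖q‖ ^ k * ‖iteratedFDeriv ℝ i (H ε) q‖ ≤ C * ε ^ M) (M : ℕ) :
    Tendsto (fun ε : ℝ => (ε ^ M)⁻¹ • H ε) (𝓝[>] (0 : ℝ)) (𝓝 0) := by
  rw [(schwartz_withSeminorms ℝ E F).tendsto_nhds]
  rintro ⟨k, i⟩ δ hδ
  obtain ⟨C, hC⟩ := hH k i (M + 1)
  have hlim : Tendsto (fun ε : ℝ => C * ε) (𝓝[>] 0) (𝓝 0) := by
    have : Tendsto (fun ε : ℝ => C * ε) (𝓝 0) (𝓝 (C * 0)) := tendsto_id.const_mul C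
    rw [mul_zero] at this
    exact this.mono_left nhdsWithin_le_nhds
  filter_upwards [hlim.eventually (gt_mem_nhds hδ), Ioc_mem_nhdsGT zero_lt_one] with ε hCε hε
  have hε0 : 0 < ε := hε.1
  have hsemi : SchwartzMap.seminorm ℝ k i (H ε) ≤ C * ε ^ (M + 1) :=
    SchwartzMap.seminorm_le_bound ℝ k i (H ε)
      (le_trans (by positivity) (hC ε hε 0)) (hC ε hε)
  rw [sub_zero]
  calc SchwartzMap.seminorm ℝ k i ((ε ^ M)⁻¹ • H ε)
      = (ε ^ M)⁻¹ * SchwartzMap.seminorm ℝ k i (H ε) := by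
        rw [map_smul_eq_mul, Real.norm_of_nonneg (by positivity)]
    _ ≤ (ε ^ M)⁻¹ * (C * ε ^ (M + 1)) := by gcongr
    _ = C * ε := by
        field_simp
        ring
    _ < δ := hCε

/-- **Rapid vanishing, in the Schwartz topology, of the scaled product cut off away from the
origin.**  Let `n ≥ 1`, `G ∈ 𝓢(ℝ⁴,ℂ)`, and let `χ : ℝ^{4n} → ℂ` be smooth with all
derivatives bounded and `χ ≡ 1` near `0`.  Then the functions
`h_ε(q₁,…,qₙ) = (1 − χ(q)) ∏ᵢ G(qᵢ/ε)` (for `ε ∈ (0,1]`) are Schwartz, every Schwartz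
seminorm of `h_ε` is `O(ε^M)` for every `M`, and `ε^{−M} h_ε → 0` in `𝓢(ℝ^{4n})` as
`ε → 0⁺`. -/
theorem cutoff_scaled_product_schwartz_rapidly_vanishing
    (n : ℕ) (hn : 1 ≤ n)
    (G : SchwartzMap V4 ℂ)
    (χ : (Fin n → V4) → ℂ)
    (hχ_smooth : ContDiff ℝ ∞ χ)
    (hχ_bdd : ∀ i : ℕ, ∃ C : ℝ, ∀ x, ‖iteratedFDeriv ℝ i χ x‖ ≤ C)
    (hχ_one : ∀ᶠ x in 𝓝 (0 : Fin n → V4), χ x = 1) :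
    ∃ H : ℝ → SchwartzMap (Fin n → V4) ℂ,
      (∀ ε : ℝ, ε ∈ Set.Ioc (0 : ℝ) 1 → ∀ q : Fin n → V4,
        H ε q = (1 - χ q) * ∏ i : Fin n, G (ε⁻¹ • q i)) ∧
      (∀ k i M : ℕ, ∃ C : ℝ, ∀ ε ∈ Set.Ioc (0 : ℝ) 1, ∀ q : Fin n → V4,
        ‖q‖ ^ k * ‖iteratedFDeriv ℝ i (⇑(H ε)) q‖ ≤ C * ε ^ M) ∧
      (∀ M : ℕ, Tendsto (fun ε : ℝ => (ε ^ M)⁻¹ • H ε) (𝓝[>] (0 : ℝ)) (𝓝 0)) := by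
  obtain ⟨P, hP⟩ := G.exists_eq_prod_apply (ι := Fin n)
  have hψ : ContDiff ℝ ∞ (fun q => 1 - χ q) := contDiff_const.sub hχ_smooth
  have hψ_bdd (i : ℕ) : ∃ C : ℝ, ∀ x, ‖iteratedFDeriv ℝ i (fun q => 1 - χ q) x‖ ≤ C := by
    obtain ⟨C, hC⟩ := hχ_bdd i
    refine ⟨1 + C, fun x => ?_⟩
    rw [show (fun q => 1 - χ q) = (fun _ => (1 : ℂ)) - χ from rfl,
      iteratedFDeriv_sub_apply contDiff_const.contDiffAt
        (hχ_smooth.of_le (mod_cast le_top)).contDiffAt]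
    refine (norm_sub_le _ _).trans (add_le_add ?_ (hC x))
    rcases eq_or_ne i 0 with rfl | hi
    · simp
    · simp [iteratedFDeriv_const_of_ne hi]
  have hψ_zero : (fun q => 1 - χ q) =ᶠ[𝓝 0] 0 := by
    filter_upwards [hχ_one] with q hq
    simp [hq]
  have hbound := P.exists_bound_mul_comp_inv_smul hψ hψ_bdd hψ_zero
  have hex (ε : ℝ) : ∃ h : SchwartzMap (Fin n → V4) ℂ, ε ∈ Set.Ioc (0 : ℝ) 1 →
      ⇑h = fun q => (1 - χ q) * P (ε⁻¹ • q) := by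
    by_cases hε : ε ∈ Set.Ioc (0 : ℝ) 1
    · refine ⟨⟨fun q => (1 - χ q) * P (ε⁻¹ • q),
        hψ.mul ((P.smooth ⊤).comp (contDiff_const_smul ε⁻¹)), fun k i => ?_⟩, fun _ => rfl⟩
      obtain ⟨C, hC⟩ := hbound k i 0
      exact ⟨C * ε ^ 0, hC ε hε⟩
    · exact ⟨0, fun h => absurd h hε⟩
  choose H hH using hex
  have hdecay (k i M : ℕ) : ∃ C : ℝ, ∀ ε ∈ Set.Ioc (0 : ℝ) 1, ∀ q : Fin n → V4,
      ‖q‖ ^ k * ‖iteratedFDeriv ℝ i (⇑(H ε)) q‖ ≤ C * ε ^ M := by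
    obtain ⟨C, hC⟩ := hbound k i M
    refine ⟨C, fun ε hε q => ?_⟩
    rw [hH ε hε]
    exact hC ε hε q
  refine ⟨H, fun ε hε q => ?_, hdecay, SchwartzMap.tendsto_inv_pow_smul_of_bound hdecay⟩
  rw [hH ε hε]
  simp only [hP, Pi.smul_apply]
end
end

section
/- Let u : ℝ⁴ → ℂ be continuous, and suppose there are constants C > 0 and K ∈ ℕ such that |u(q)| ≤ C|q|⁵ whenever |q| ≤ 1 and |u(q)| ≤ C(1+|q|)^K for all q ∈ ℝ⁴. Then for every G ∈ 𝓢(ℝ⁴, ℂ): lim_{ε→0⁺} ∫_{ℝ⁴} G(q) · ε^{−4} u(εq) d⁴q = 0. -/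
open MeasureTheory Filter Topology

noncomputable section

/-- A function that vanishes to order `m` at the origin and grows at most polynomially is dominated
by a combination of two powers of the norm, each of order at least `m`. -/
theorem norm_le_of_vanishing_order_of_polynomial_growth {E F : Type*} [NormedAddCommGroup E]
    [NormedAddCommGroup F] {u : E → F} {C : ℝ} (hC : 0 ≤ C) {K m : ℕ}
    (hsmall : ∀ q, ‖q‖ ≤ 1 → ‖u q‖ ≤ C * ‖q‖ ^ m)
    (hpoly : ∀ q, ‖u q‖ ≤ C * (1 + ‖q‖) ^ K) (q : E) :
    ‖u q‖ ≤ C * 2 ^ K * (‖q‖ ^ m + ‖q‖ ^ (K + m)) := by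
  have h2 : (1 : ℝ) ≤ 2 ^ K := one_le_pow₀ one_le_two
  rcases le_total ‖q‖ 1 with hq | hq
  · calc ‖u q‖ ≤ C * 1 * (‖q‖ ^ m + 0) := by simpa using hsmall q hq
      _ ≤ C * 2 ^ K * (‖q‖ ^ m + ‖q‖ ^ (K + m)) := by gcongr; positivity
  · calc ‖u q‖ ≤ C * (1 + ‖q‖) ^ K := hpoly q
      _ ≤ C * (2 * ‖q‖) ^ K := by gcongr; linarith
      _ = C * 2 ^ K * (0 + ‖q‖ ^ K) := by ring
      _ ≤ C * 2 ^ K * (‖q‖ ^ m + ‖q‖ ^ (K + m)) := by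
        gcongr
        · positivity
        · omega

/-- **Vanishing of the vacuum-bubble contribution in the adiabatic limit.**
Let `u : ℝ⁴ → ℂ` be continuous with `|u(q)| ≤ C|q|⁵` for `|q| ≤ 1` and
`|u(q)| ≤ C(1+|q|)^K` for all `q`.  Then for every Schwartz `G` on `ℝ⁴`,
`∫ G(q) ε^{−4} u(εq) d⁴q → 0` as `ε → 0⁺`. -/
theorem vacuum_bubble_adiabatic_limit_vanishes
    (u : EuclideanSpace ℝ (Fin 4) → ℂ) (hcont : Continuous u)
    (C : ℝ) (hC : 0 < C) (K : ℕ)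
    (hsmall : ∀ q : EuclideanSpace ℝ (Fin 4), ‖q‖ ≤ 1 → ‖u q‖ ≤ C * ‖q‖ ^ 5)
    (hpoly : ∀ q : EuclideanSpace ℝ (Fin 4), ‖u q‖ ≤ C * (1 + ‖q‖) ^ K)
    (G : SchwartzMap (EuclideanSpace ℝ (Fin 4)) ℂ) :
    Tendsto (fun ε : ℝ =>
        ∫ q : EuclideanSpace ℝ (Fin 4),
          G q * ((ε ^ (-4 : ℤ) : ℝ) : ℂ) * u (ε • q))
      (𝓝[>] (0 : ℝ)) (𝓝 0) := by
  set B : EuclideanSpace ℝ (Fin 4) → ℝ :=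
    fun q => C * 2 ^ K * (‖q‖ ^ 5 * ‖G q‖ + ‖q‖ ^ (K + 5) * ‖G q‖)
  have hB : Integrable B :=
    ((G.integrable_pow_mul volume 5).add (G.integrable_pow_mul volume (K + 5))).const_mul _
  have hbound : ∀ᶠ ε : ℝ in 𝓝[>] 0,
      ‖∫ q : EuclideanSpace ℝ (Fin 4), G q * ((ε ^ (-4 : ℤ) : ℝ) : ℂ) * u (ε • q)‖
        ≤ ε * ∫ q, B q := by
    filter_upwards [Ioc_mem_nhdsGT (zero_lt_one' ℝ)] with ε ⟨hε, hε1⟩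
    rw [← integral_const_mul]
    refine norm_integral_le_of_norm_le (hB.const_mul ε) (ae_of_all _ fun q => ?_)
    have hu : ‖u (ε • q)‖ ≤ C * 2 ^ K * (ε ^ 5 * (‖q‖ ^ 5 + ‖q‖ ^ (K + 5))) :=
      calc ‖u (ε • q)‖ ≤ C * 2 ^ K * (‖ε • q‖ ^ 5 + ‖ε • q‖ ^ (K + 5)) :=
            norm_le_of_vanishing_order_of_polynomial_growth hC.le hsmall hpoly _
        _ = C * 2 ^ K * (ε ^ 5 * (‖q‖ ^ 5 + ε ^ K * ‖q‖ ^ (K + 5))) := by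
            rw [norm_smul, Real.norm_of_nonneg hε.le]; ring
        _ ≤ C * 2 ^ K * (ε ^ 5 * (‖q‖ ^ 5 + ‖q‖ ^ (K + 5))) := by
            gcongr
            exact mul_le_of_le_one_left (by positivity) (pow_le_one₀ hε.le hε1)
    have hscale : ε ^ (-4 : ℤ) * ε ^ 5 = ε := by
      rw [← zpow_natCast, ← zpow_add₀ hε.ne']; norm_num
    calc ‖G q * ((ε ^ (-4 : ℤ) : ℝ) : ℂ) * u (ε • q)‖
        = ‖G q‖ * ε ^ (-4 : ℤ) * ‖u (ε • q)‖ := by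
          rw [norm_mul, norm_mul, Complex.norm_real, Real.norm_of_nonneg (by positivity)]
      _ ≤ ‖G q‖ * ε ^ (-4 : ℤ) * (C * 2 ^ K * (ε ^ 5 * (‖q‖ ^ 5 + ‖q‖ ^ (K + 5)))) := by
          gcongr
      _ = (ε ^ (-4 : ℤ) * ε ^ 5) * B q := by ring
      _ = ε * B q := by rw [hscale]
  refine squeeze_zero_norm' hbound ?_
  have hlim : Tendsto (fun ε : ℝ => ε * ∫ q, B q) (𝓝 0) (𝓝 (0 * ∫ q, B q)) :=
    tendsto_id.mul_const _
  rw [zero_mul] at hlim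
  exact hlim.mono_left nhdsWithin_le_nhds
end
end

section
/- Let m > 0, let G ∈ 𝓢(ℝ⁴, ℂ), set E(p⃗) := √(|p⃗|² + m²), and let M ∈ ℕ. Then there is a constant C such that for all ε ∈ (0,1]: ∫_{ℝ⁹} d³p⃗₁ d³p⃗₂ d³k⃗ / ((2π)⁹ · 8 E(p⃗₁) E(p⃗₂) |k⃗|) · ε^{−8} | G( (E(p⃗₁) + E(p⃗₂) + |k⃗|)/ε , (p⃗₁ + p⃗₂ + k⃗)/ε ) |² ≤ C ε^M. (Thus the squared L² norm of the first-order amplitude for the creation of two electrons and one photon out of the vacuum is O(ε^M) for every M, so this kinematically forbidden process vanishes in the adiabatic limit.) -/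
open MeasureTheory Filter Topology Real

noncomputable section

/-- The relativistic energy `E(p⃗) = √(|p⃗|² + m²)`. -/
def En (m : ℝ) (p : V3) : ℝ := Real.sqrt (‖p‖ ^ 2 + m ^ 2)

/-- The polynomial weight `(1 + ‖p‖)⁻⁴` is integrable on `ℝ³`. -/
lemma integrable_one_add_norm_pow_four_inv :
    Integrable (fun p : V3 => ((1 + ‖p‖) ^ 4)⁻¹) := by
  have h := integrable_one_add_norm (E := V3) (μ := volume) (r := 4) (by simp; norm_num)
  refine h.congr (ae_of_all _ fun p => ?_)
  have hp : 0 ≤ 1 + ‖p‖ := by positivity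
  simp only
  rw [Real.rpow_neg hp]
  norm_cast

/-- The weight `(1 + ‖k‖)⁻⁴ / ‖k‖` is integrable on `ℝ³`. -/
lemma integrable_one_add_norm_pow_four_inv_mul_norm_inv :
    Integrable (fun k : V3 => ((1 + ‖k‖) ^ 4)⁻¹ * ‖k‖⁻¹) := by
  rw [integrable_fun_norm_addHaar (volume : Measure V3)
    (f := fun y : ℝ => ((1 + y) ^ 4)⁻¹ * y⁻¹)]
  have h := integrable_one_add_norm (E := ℝ) (μ := volume) (r := 3) (by simp)
  refine (h.integrableOn (s := Set.Ioi 0)).mono' (by fun_prop) ?_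
  filter_upwards [ae_restrict_mem measurableSet_Ioi] with y hy
  have hy : 0 < y := hy
  rw [Real.norm_of_nonneg hy.le, Real.rpow_neg (by positivity)]
  have hd : Module.finrank ℝ V3 - 1 = 2 := by simp
  rw [hd, smul_eq_mul, Real.norm_of_nonneg (by positivity)]
  have h3 : (1 + y) ^ (3 : ℝ) = (1 + y) ^ 3 := by norm_cast
  rw [h3]
  have e : y ^ 2 * (((1 + y) ^ 4)⁻¹ * y⁻¹) = (y / (1 + y)) * ((1 + y) ^ 3)⁻¹ := by
    field_simp
  rw [e]
  exact mul_le_of_le_one_left (by positivity) ((div_le_one (by positivity)).2 (by linarith))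

lemma le_En {m : ℝ} (p : V3) : m ≤ En m p :=
  Real.le_sqrt_of_sq_le (by nlinarith [sq_nonneg ‖p‖])

lemma norm_le_En (m : ℝ) (p : V3) : ‖p‖ ≤ En m p :=
  Real.le_sqrt_of_sq_le (by nlinarith [sq_nonneg m])

/-- Rapid decay of a Schwartz function at rescaled arguments, in terms of the first component. -/
lemma exists_norm_sq_le_of_rescaled (G : SchwartzMap (ℝ × V3) ℂ) (n : ℕ) :
    ∃ D : ℝ, 0 ≤ D ∧ ∀ ε S : ℝ, 0 < ε → 0 < S → ∀ q : V3,
      ‖G (S / ε, q)‖ ^ 2 ≤ D * (ε ^ (2 * n) / S ^ (2 * n)) := by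
  obtain ⟨D, hD, hG⟩ := G.decay n 0
  refine ⟨D ^ 2, by positivity, fun ε S hε hS q => ?_⟩
  have h := hG (S / ε, q)
  rw [norm_iteratedFDeriv_zero] at h
  have hx : S / ε ≤ ‖((S / ε, q) : ℝ × V3)‖ :=
    (le_abs_self _).trans (norm_fst_le ((S / ε, q) : ℝ × V3))
  have h1 : (S / ε) ^ n * ‖G (S / ε, q)‖ ≤ D :=
    (by gcongr : (S / ε) ^ n * ‖G (S / ε, q)‖ ≤
      ‖((S / ε, q) : ℝ × V3)‖ ^ n * ‖G (S / ε, q)‖).trans h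
  have h2 : ‖G (S / ε, q)‖ ≤ D * (ε ^ n / S ^ n) := by
    rw [div_pow, div_mul_eq_mul_div, div_le_iff₀ (by positivity)] at h1
    rw [← mul_div_assoc, le_div_iff₀ (by positivity)]
    linarith
  calc ‖G (S / ε, q)‖ ^ 2 ≤ (D * (ε ^ n / S ^ n)) ^ 2 := by gcongr
    _ = D ^ 2 * (ε ^ (2 * n) / S ^ (2 * n)) := by
      rw [mul_pow, div_pow, ← pow_mul, ← pow_mul, mul_comm n 2]

/-- **Rapid vanishing of the kinematically forbidden first-order vacuum decay into two
electrons and one photon.**  For `m > 0`, Schwartz `G` on `ℝ⁴`, and every `M ∈ ℕ`, there is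
`C` such that for all `ε ∈ (0,1]`:
`∫ d³p⃗₁d³p⃗₂d³k⃗/((2π)⁹ 8E(p⃗₁)E(p⃗₂)|k⃗|) ε^{−8}
   |G((E(p⃗₁)+E(p⃗₂)+|k⃗|)/ε, (p⃗₁+p⃗₂+k⃗)/ε)|² ≤ C ε^M`. -/
theorem vacuum_decay_two_electrons_photon_rapidly_vanishing
    (m : ℝ) (hm : 0 < m) (G : SchwartzMap (ℝ × V3) ℂ) (M : ℕ) :
    ∃ C : ℝ, ∀ ε : ℝ, ε ∈ Set.Ioc (0 : ℝ) 1 →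
      (∫⁻ pk : V3 × V3 × V3,
          ENNReal.ofReal (
            (1 / ((2 * π) ^ 9 * 8 * En m pk.1 * En m pk.2.1 * ‖pk.2.2‖))
              * (ε ^ (-8 : ℤ))
              * ‖G ((En m pk.1 + En m pk.2.1 + ‖pk.2.2‖) / ε,
                    ε⁻¹ • (pk.1 + pk.2.1 + pk.2.2))‖ ^ 2))
        ≤ ENNReal.ofReal (C * ε ^ M) := by
  obtain ⟨D, hD, hG⟩ := exists_norm_sq_le_of_rescaled G (M + 6)
  set c : ℝ := min m 1 / 2 with hc
  have hc0 : 0 < c := by positivity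
  have hcm : 2 * c ≤ m := by rw [hc]; linarith [min_le_left m 1]
  have hc1 : 2 * c ≤ 1 := by rw [hc]; linarith [min_le_right m 1]
  set K : ℝ := 1 / ((2 * π) ^ 9 * 8 * m * m) * (D / c ^ (2 * (M + 6))) with hK
  have hK0 : 0 ≤ K := by positivity
  set w : V3 × V3 × V3 → ℝ := fun pk =>
    ((1 + ‖pk.1‖) ^ 4)⁻¹ * (((1 + ‖pk.2.1‖) ^ 4)⁻¹ * (((1 + ‖pk.2.2‖) ^ 4)⁻¹ * ‖pk.2.2‖⁻¹))
    with hw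
  have hwi : Integrable w :=
    integrable_one_add_norm_pow_four_inv.mul_prod
      (integrable_one_add_norm_pow_four_inv.mul_prod
        integrable_one_add_norm_pow_four_inv_mul_norm_inv)
  refine ⟨K * ∫ pk, w pk, fun ε hε => ?_⟩
  obtain ⟨hε0, hε1⟩ := hε
  have hint : ENNReal.ofReal (K * (∫ pk, w pk) * ε ^ M)
      = ∫⁻ pk, ENNReal.ofReal (K * ε ^ M * w pk) := by
    rw [← ofReal_integral_eq_lintegral_ofReal (hwi.const_mul _)
      (ae_of_all _ fun pk => by simp only [hw, Pi.zero_apply]; positivity), integral_const_mul]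
    congr 1
    ring
  rw [hint]
  refine lintegral_mono fun pk => ENNReal.ofReal_le_ofReal ?_
  obtain ⟨p, q, k⟩ := pk
  simp only [hw]
  have hpm := le_En (m := m) p
  have hqm := le_En (m := m) q
  have hpn := norm_le_En m p
  have hqn := norm_le_En m q
  have hp0 := norm_nonneg p
  have hq0 := norm_nonneg q
  have hk0 := norm_nonneg k
  set S : ℝ := En m p + En m q + ‖k‖ with hS
  have hS0 : 0 < S := by linarith
  have hcp : c * (1 + ‖p‖) ≤ S := by nlinarith
  have hcq : c * (1 + ‖q‖) ≤ S := by nlinarith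
  have hck : c * (1 + ‖k‖) ≤ S := by nlinarith
  have hcS : c ≤ S := by linarith
  have hSn : c ^ (2 * (M + 6)) * ((1 + ‖p‖) ^ 4 * (1 + ‖q‖) ^ 4 * (1 + ‖k‖) ^ 4)
      ≤ S ^ (2 * (M + 6)) := by
    calc _ = c ^ (2 * M) * (c * (1 + ‖p‖)) ^ 4 * (c * (1 + ‖q‖)) ^ 4 * (c * (1 + ‖k‖)) ^ 4 := by
          ring
      _ ≤ S ^ (2 * M) * S ^ 4 * S ^ 4 * S ^ 4 := by gcongr
      _ = S ^ (2 * (M + 6)) := by ring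
  have hεM : ε ^ (-8 : ℤ) * ε ^ (2 * (M + 6)) ≤ ε ^ M := by
    have e : ε ^ (-8 : ℤ) * ε ^ (2 * (M + 6)) = ε ^ (2 * M + 4) := by
      rw [show 2 * (M + 6) = 2 * M + 4 + 8 by ring, pow_add _ (2 * M + 4) 8, zpow_neg]
      norm_cast
      field_simp
    rw [e]
    exact pow_le_pow_of_le_one hε0.le hε1 (by omega)
  have hmeas : 1 / ((2 * π) ^ 9 * 8 * En m p * En m q * ‖k‖)
      ≤ 1 / ((2 * π) ^ 9 * 8 * m * m) * ‖k‖⁻¹ := by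
    have hEp : 0 ≤ En m p := hm.le.trans hpm
    rw [← div_div, div_eq_mul_inv _ ‖k‖]
    gcongr
  calc _ ≤ (1 / ((2 * π) ^ 9 * 8 * m * m) * ‖k‖⁻¹) * ε ^ (-8 : ℤ)
        * (D * (ε ^ (2 * (M + 6)) / S ^ (2 * (M + 6)))) := by
        gcongr
        exact hG ε S hε0 hS0 _
    _ = (1 / ((2 * π) ^ 9 * 8 * m * m) * ‖k‖⁻¹) * D
        * ((ε ^ (-8 : ℤ) * ε ^ (2 * (M + 6))) / S ^ (2 * (M + 6))) := by ring
    _ ≤ (1 / ((2 * π) ^ 9 * 8 * m * m) * ‖k‖⁻¹) * D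
        * (ε ^ M / (c ^ (2 * (M + 6))
          * ((1 + ‖p‖) ^ 4 * (1 + ‖q‖) ^ 4 * (1 + ‖k‖) ^ 4))) := by gcongr
    _ = _ := by
      rw [hK]
      simp only [div_eq_mul_inv, mul_inv]
      ring
end
end

section
/- Let f : ℝ⁴ → ℂ be continuous and suppose sup_{(t, y⃗) ∈ ℝ⁴} (1 + |t|)³ |f(t, y⃗)| < ∞. Then for every x = (x⁰, x⃗) ∈ ℝ⁴ the function y⃗ ↦ f(x⁰ − |x⃗ − y⃗|, y⃗) / |x⃗ − y⃗| is Lebesgue integrable on ℝ³, and the function F : ℝ⁴ → ℂ, F(x) := (1/(4π)) ∫_{ℝ³} f(x⁰ − |x⃗ − y⃗|, y⃗) / |x⃗ − y⃗| d³y⃗, is continuous on ℝ⁴. -/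
open MeasureTheory Filter Topology Real

noncomputable section

/-- The profile `1 / ((1 + r)³ r)` of the retarded kernel is integrable over `ℝ³`: it behaves like
`r⁻¹` at the origin and like `r⁻⁴` at infinity. -/
lemma integrable_inv_one_add_norm_pow_mul_norm :
    Integrable (fun z : V3 => ((1 + ‖z‖) ^ 3 * ‖z‖)⁻¹) := by
  refine (integrable_fun_norm_addHaar (volume : Measure V3)
    (f := fun r : ℝ => ((1 + r) ^ 3 * r)⁻¹)).2 ?_
  have hint : IntegrableOn (fun r : ℝ => (r + 1) ^ (-2 : ℝ)) (Set.Ioi 0) :=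
    integrableOn_add_rpow_Ioi_of_lt (by norm_num) (by norm_num)
  refine hint.mono' (by fun_prop) ?_
  filter_upwards [ae_restrict_mem measurableSet_Ioi] with r hr
  have hr : 0 < r := hr
  have hdim : Module.finrank ℝ V3 - 1 = 2 := by simp
  rw [hdim, smul_eq_mul, Real.norm_of_nonneg (by positivity), Real.rpow_neg (by positivity),
    show (2 : ℝ) = ((2 : ℕ) : ℝ) by norm_num, Real.rpow_natCast, ← div_eq_mul_inv, ← one_div,
    div_le_div_iff₀ (by positivity) (by positivity)]
  nlinarith [pow_pos hr 2, pow_pos hr 3]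

/-- The retarded integrand in the variable `z = x⃗ - y⃗`, which moves the singularity to the
origin. -/
def retardedIntegrand (f : ℝ × V3 → ℂ) (x : ℝ × V3) (z : V3) : ℂ :=
  f (x.1 - ‖z‖, x.2 - z) / (‖z‖ : ℂ)

lemma retardedIntegrand_sub (f : ℝ × V3 → ℂ) (x : ℝ × V3) (y : V3) :
    retardedIntegrand f x (x.2 - y) = f (x.1 - ‖x.2 - y‖, y) / (‖x.2 - y‖ : ℂ) := by
  simp [retardedIntegrand]

lemma aestronglyMeasurable_retardedIntegrand {f : ℝ × V3 → ℂ} (hcont : Continuous f)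
    (x : ℝ × V3) : AEStronglyMeasurable (retardedIntegrand f x) := by
  have h : Continuous fun z : V3 => f (x.1 - ‖z‖, x.2 - z) := by fun_prop
  exact (h.measurable.div
    (Complex.measurable_ofReal.comp measurable_norm)).aestronglyMeasurable

lemma norm_retardedIntegrand_le {f : ℝ × V3 → ℂ} {C : ℝ}
    (hbound : ∀ p : ℝ × V3, (1 + |p.1|) ^ 3 * ‖f p‖ ≤ C) {R : ℝ} {x : ℝ × V3}
    (hx : |x.1| ≤ R) (z : V3) :
    ‖retardedIntegrand f x z‖ ≤ (1 + R) ^ 3 * C * ((1 + ‖z‖) ^ 3 * ‖z‖)⁻¹ := by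
  have hR : 0 ≤ R := (abs_nonneg _).trans hx
  have htri : 1 + ‖z‖ ≤ (1 + R) * (1 + |x.1 - ‖z‖|) := by
    have h₁ : ‖z‖ ≤ |x.1| + |x.1 - ‖z‖| := by
      linarith [le_abs_self x.1, neg_abs_le (x.1 - ‖z‖)]
    nlinarith [mul_nonneg hR (abs_nonneg (x.1 - ‖z‖))]
  have hf : ‖f (x.1 - ‖z‖, x.2 - z)‖ ≤ (1 + R) ^ 3 * C / (1 + ‖z‖) ^ 3 := by
    rw [le_div_iff₀ (by positivity)]
    calc ‖f (x.1 - ‖z‖, x.2 - z)‖ * (1 + ‖z‖) ^ 3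
        ≤ ‖f (x.1 - ‖z‖, x.2 - z)‖ * ((1 + R) * (1 + |x.1 - ‖z‖|)) ^ 3 := by gcongr
      _ = (1 + R) ^ 3 * ((1 + |x.1 - ‖z‖|) ^ 3 * ‖f (x.1 - ‖z‖, x.2 - z)‖) := by ring
      _ ≤ (1 + R) ^ 3 * C := by gcongr; exact hbound (x.1 - ‖z‖, x.2 - z)
  rw [retardedIntegrand, norm_div, Complex.norm_real, norm_norm, mul_inv, ← mul_assoc,
    ← div_eq_mul_inv, ← div_eq_mul_inv]
  gcongr

lemma integrable_retardedIntegrand {f : ℝ × V3 → ℂ} (hcont : Continuous f) {C : ℝ}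
    (hbound : ∀ p : ℝ × V3, (1 + |p.1|) ^ 3 * ‖f p‖ ≤ C) (x : ℝ × V3) :
    Integrable (retardedIntegrand f x) :=
  (integrable_inv_one_add_norm_pow_mul_norm.const_mul _).mono'
    (aestronglyMeasurable_retardedIntegrand hcont x)
    (ae_of_all _ (norm_retardedIntegrand_le hbound le_rfl))

lemma continuous_integral_retardedIntegrand {f : ℝ × V3 → ℂ} (hcont : Continuous f) {C : ℝ}
    (hbound : ∀ p : ℝ × V3, (1 + |p.1|) ^ 3 * ‖f p‖ ≤ C) :
    Continuous fun x : ℝ × V3 => ∫ z, retardedIntegrand f x z := by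
  refine continuous_iff_continuousAt.2 fun x₀ => ?_
  have hnhds : ∀ᶠ x : ℝ × V3 in 𝓝 x₀, |x.1| ≤ |x₀.1| + 1 :=
    (continuous_fst.abs.tendsto x₀).eventually_le_const (lt_add_one _)
  refine continuousAt_of_dominated
    (.of_forall (aestronglyMeasurable_retardedIntegrand hcont))
    (hnhds.mono fun x hx => ae_of_all _ (norm_retardedIntegrand_le hbound hx))
    (integrable_inv_one_add_norm_pow_mul_norm.const_mul _) (ae_of_all _ fun z => ?_)
  unfold retardedIntegrand
  exact (Continuous.div_const (by fun_prop) _).continuousAt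

/-- **Integrability and continuity of the retarded solution of the wave equation.**
Let `f : ℝ⁴ = ℝ × ℝ³ → ℂ` be continuous with `(1+|t|)³ |f(t,y⃗)| ≤ C` for all `(t,y⃗)`.
Then for every `x = (x⁰,x⃗)` the function `y⃗ ↦ f(x⁰ − |x⃗−y⃗|, y⃗)/|x⃗−y⃗|` is Lebesgue
integrable on `ℝ³`, and `x ↦ (1/4π) ∫ d³y⃗ f(x⁰ − |x⃗−y⃗|, y⃗)/|x⃗−y⃗|` is continuous. -/
theorem retarded_wave_solution_integrable_continuous
    (f : ℝ × V3 → ℂ) (hcont : Continuous f)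
    (C : ℝ) (hbound : ∀ p : ℝ × V3, (1 + |p.1|) ^ 3 * ‖f p‖ ≤ C) :
    (∀ x : ℝ × V3,
      Integrable (fun y : V3 => f (x.1 - ‖x.2 - y‖, y) / (‖x.2 - y‖ : ℂ))) ∧
    Continuous (fun x : ℝ × V3 =>
      (1 / (4 * π) : ℂ) * ∫ y : V3, f (x.1 - ‖x.2 - y‖, y) / (‖x.2 - y‖ : ℂ)) := by
  simp_rw [← retardedIntegrand_sub]
  refine ⟨fun x => (integrable_retardedIntegrand hcont hbound x).comp_sub_left x.2, ?_⟩
  simp_rw [fun x : ℝ × V3 => integral_sub_left_eq_self (retardedIntegrand f x) volume x.2]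
  exact continuous_const.mul (continuous_integral_retardedIntegrand hcont hbound)
end
end

section
/- Let m > 0 and e > 0, and let x : ℝ → ℝ³ \ {0} be twice differentiable and satisfy the repulsive Coulomb equation of motion m x''(t) = (e²/(4π)) x(t)/|x(t)|³ for all t ∈ ℝ. Then: (i) there exist x_∞ ∈ ℝ³ and v_∞ ∈ ℝ³ with v_∞ ≠ 0 such that lim_{t→∞} | x(t) − x_∞ − t v_∞ + (e²/(4π m)) (v_∞/|v_∞|³) log t | = 0; and (ii) for all x₀, v₀ ∈ ℝ³ it is NOT the case that lim_{t→∞} | x(t) − x₀ − t v₀ | = 0, i.e. the trajectory is not asymptotic to any free (straight-line) trajectory. -/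
open Filter Topology Real

noncomputable section

section DerivBound

variable {F : Type*} [NormedAddCommGroup F] [NormedSpace ℝ F]

theorem norm_sub_le_sub_of_norm_deriv_le {f f' : ℝ → F} {B B' : ℝ → ℝ} {T : ℝ}
    (hf : ∀ t, T ≤ t → HasDerivAt f (f' t) t) (hB : ∀ t, T ≤ t → HasDerivAt B (B' t) t)
    (hle : ∀ t, T ≤ t → ‖f' t‖ ≤ B' t) {t s : ℝ} (hTt : T ≤ t) (hts : t ≤ s) :
    ‖f s - f t‖ ≤ B s - B t := by
  have key := image_norm_le_of_norm_deriv_right_le_deriv_boundary'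
    (f := fun r => f r - f t) (f' := f') (a := t) (b := s)
    (B := fun r => B r - B t) (B' := B')
    (fun r hr => ((hf r (hTt.trans hr.1)).continuousAt.sub continuousAt_const).continuousWithinAt)
    (fun r hr => ((hf r (hTt.trans hr.1)).sub_const _).hasDerivWithinAt)
    (by simp)
    (fun r hr => ((hB r (hTt.trans hr.1)).continuousAt.sub continuousAt_const).continuousWithinAt)
    (fun r hr => ((hB r (hTt.trans hr.1)).sub_const _).hasDerivWithinAt)
    (fun r hr => hle r (hTt.trans hr.1))
  exact key (Set.right_mem_Icc.2 hts)

/-- A function whose derivative is dominated by that of a convergent real function converges. -/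
theorem exists_tendsto_of_norm_deriv_le [CompleteSpace F] {f f' : ℝ → F} {B B' : ℝ → ℝ} {T b : ℝ}
    (hf : ∀ t, T ≤ t → HasDerivAt f (f' t) t) (hB : ∀ t, T ≤ t → HasDerivAt B (B' t) t)
    (hle : ∀ t, T ≤ t → ‖f' t‖ ≤ B' t) (hb : Tendsto B atTop (𝓝 b)) :
    ∃ L, Tendsto f atTop (𝓝 L) ∧ ∀ t, T ≤ t → ‖f t - L‖ ≤ b - B t := by
  have hdiff : ∀ t s, T ≤ t → t ≤ s → ‖f s - f t‖ ≤ B s - B t := fun t s h h' =>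
    norm_sub_le_sub_of_norm_deriv_le hf hB hle h h'
  have hcauchy : CauchySeq f := by
    rw [Metric.cauchySeq_iff']
    intro ε hε
    obtain ⟨N, hN⟩ := Metric.cauchySeq_iff'.1 hb.cauchySeq (ε / 2) (half_pos hε)
    refine ⟨max N T, fun n hn => ?_⟩
    have h1 := hN n ((le_max_left _ _).trans hn)
    have h2 := hN (max N T) (le_max_left _ _)
    have h3 := hdiff (max N T) n (le_max_right _ _) hn
    rw [Real.dist_eq, abs_lt] at h1 h2
    rw [dist_eq_norm]
    linarith [h1.1, h1.2, h2.1, h2.2]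
  obtain ⟨L, hL⟩ := cauchySeq_tendsto_of_complete hcauchy
  refine ⟨L, hL, fun t ht => ?_⟩
  rw [norm_sub_rev]
  refine le_of_tendsto_of_tendsto (hL.sub_const (f t)).norm (hb.sub_const (B t)) ?_
  filter_upwards [eventually_ge_atTop t] with s hs using hdiff t s ht hs

/-- A derivative that is `O(t ^ (-1 - a))` with `a > 0` forces convergence at rate
`O(t ^ (-a))`. -/
theorem exists_tendsto_of_norm_deriv_le_rpow [CompleteSpace F] {f f' : ℝ → F} {T C a : ℝ}
    (hT : 0 < T) (ha : 0 < a) (hf : ∀ t, T ≤ t → HasDerivAt f (f' t) t)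
    (hle : ∀ t, T ≤ t → ‖f' t‖ ≤ C * t ^ (-a - 1)) :
    ∃ L, Tendsto f atTop (𝓝 L) ∧ ∀ t, T ≤ t → ‖f t - L‖ ≤ C / a * t ^ (-a) := by
  have hB : ∀ t, T ≤ t → HasDerivAt (fun t : ℝ => -(C / a) * t ^ (-a)) (C * t ^ (-a - 1)) t := by
    intro t ht
    refine ((Real.hasDerivAt_rpow_const (p := -a)
      (Or.inl (hT.trans_le ht).ne')).const_mul (-(C / a))).congr_deriv ?_
    field_simp
  have hb : Tendsto (fun t : ℝ => -(C / a) * t ^ (-a)) atTop (𝓝 0) := by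
    simpa using (tendsto_rpow_neg_atTop ha).const_mul (-(C / a))
  obtain ⟨L, hL, hLt⟩ := exists_tendsto_of_norm_deriv_le hf hB hle hb
  refine ⟨L, hL, fun t ht => (hLt t ht).trans_eq (by ring)⟩

theorem norm_inv_cube_smul_sub_le {p q : F} {r : ℝ} (hr : 0 < r) (hp : r ≤ ‖p‖) (hq : r ≤ ‖q‖) :
    ‖(‖p‖ ^ 3)⁻¹ • p - (‖q‖ ^ 3)⁻¹ • q‖ ≤ 4 * ‖p - q‖ / r ^ 3 := by
  have hp0 : 0 < ‖p‖ := hr.trans_le hp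
  have hq0 : 0 < ‖q‖ := hr.trans_le hq
  have hsplit : (‖p‖ ^ 3)⁻¹ • p - (‖q‖ ^ 3)⁻¹ • q
      = (‖p‖ ^ 3)⁻¹ • (p - q) + ((‖p‖ ^ 3)⁻¹ - (‖q‖ ^ 3)⁻¹) • q := by
    module
  have hcoef : |(‖p‖ ^ 3)⁻¹ - (‖q‖ ^ 3)⁻¹| * ‖q‖
      = |‖q‖ - ‖p‖| * (1 / (‖p‖ * ‖q‖ ^ 2) + 1 / (‖p‖ ^ 2 * ‖q‖) + 1 / ‖p‖ ^ 3) := by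
    have h1 : (‖p‖ ^ 3)⁻¹ - (‖q‖ ^ 3)⁻¹ = (‖q‖ - ‖p‖) *
        ((1 / (‖p‖ * ‖q‖ ^ 2) + 1 / (‖p‖ ^ 2 * ‖q‖) + 1 / ‖p‖ ^ 3) / ‖q‖) := by
      field_simp
      ring
    rw [h1, abs_mul, abs_of_pos (by positivity :
      0 < (1 / (‖p‖ * ‖q‖ ^ 2) + 1 / (‖p‖ ^ 2 * ‖q‖) + 1 / ‖p‖ ^ 3) / ‖q‖)]
    field_simp
  have b1 : 1 / (‖p‖ * ‖q‖ ^ 2) ≤ 1 / r ^ 3 := by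
    rw [show r ^ 3 = r * r ^ 2 by ring]; gcongr
  have b2 : 1 / (‖p‖ ^ 2 * ‖q‖) ≤ 1 / r ^ 3 := by
    rw [show r ^ 3 = r ^ 2 * r by ring]; gcongr
  have b3 : 1 / ‖p‖ ^ 3 ≤ 1 / r ^ 3 := by gcongr
  have b4 : |‖q‖ - ‖p‖| ≤ ‖p - q‖ := by
    rw [abs_sub_comm]; exact abs_norm_sub_norm_le p q
  calc _ ≤ ‖(‖p‖ ^ 3)⁻¹ • (p - q)‖ + ‖((‖p‖ ^ 3)⁻¹ - (‖q‖ ^ 3)⁻¹) • q‖ := by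
        rw [hsplit]; exact norm_add_le _ _
    _ = 1 / ‖p‖ ^ 3 * ‖p - q‖ + |‖q‖ - ‖p‖| *
          (1 / (‖p‖ * ‖q‖ ^ 2) + 1 / (‖p‖ ^ 2 * ‖q‖) + 1 / ‖p‖ ^ 3) := by
        rw [norm_smul, norm_smul, Real.norm_eq_abs, Real.norm_eq_abs, hcoef,
          abs_of_pos (by positivity), one_div (‖p‖ ^ 3)]
    _ ≤ 1 / r ^ 3 * ‖p - q‖ + ‖p - q‖ * (1 / r ^ 3 + 1 / r ^ 3 + 1 / r ^ 3) := by gcongr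
    _ = _ := by ring

/-- A uniform motion with a nonzero logarithmic correction does not tend to zero. -/
theorem not_tendsto_add_smul_add_log_smul {a b c : F} (hc : c ≠ 0) :
    ¬ Tendsto (fun t : ℝ => a + t • b + Real.log t • c) atTop (𝓝 0) := by
  intro h
  have h2 := h.comp (tendsto_id.const_mul_atTop (two_pos : (0 : ℝ) < 2))
  have h4 := h.comp (tendsto_id.const_mul_atTop (four_pos : (0 : ℝ) < 4))
  have hlim := (h4.sub (h2.const_smul (3 : ℝ))).add (h.const_smul (2 : ℝ))
  have heq : (fun _ : ℝ => (-Real.log 2) • c) =ᶠ[atTop] fun t : ℝ =>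
      (a + (4 * t) • b + Real.log (4 * t) • c) - (3 : ℝ) • (a + (2 * t) • b + Real.log (2 * t) • c)
        + (2 : ℝ) • (a + t • b + Real.log t • c) := by
    filter_upwards [eventually_gt_atTop 0] with t ht
    rw [Real.log_mul (by norm_num) ht.ne', Real.log_mul (by norm_num) ht.ne',
      show (4 : ℝ) = 2 ^ 2 by norm_num, Real.log_pow]
    push_cast
    module
  have hconst : Tendsto (fun _ : ℝ => (-Real.log 2) • c) atTop (𝓝 0) := by
    refine Tendsto.congr' heq.symm ?_
    simpa [Function.comp_def] using hlim
  have h0 : (-Real.log 2) • c = 0 := tendsto_nhds_unique tendsto_const_nhds hconst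
  exact smul_ne_zero (neg_ne_zero.2 (Real.log_pos one_lt_two).ne') hc h0

end DerivBound

section Coulomb

variable {F : Type*} [NormedAddCommGroup F] [InnerProductSpace ℝ F] {x v : ℝ → F} {k : ℝ}

/-- Conservation of energy. -/
theorem coulomb_energy_const (hx0 : ∀ t, x t ≠ 0) (hx : ∀ t, HasDerivAt x (v t) t)
    (hv : ∀ t, HasDerivAt v (k • (‖x t‖ ^ 3)⁻¹ • x t) t) (t : ℝ) :
    ‖v t‖ ^ 2 / 2 + k / ‖x t‖ = ‖v 0‖ ^ 2 / 2 + k / ‖x 0‖ := by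
  have hder : ∀ s, HasDerivAt (fun s => ‖v s‖ ^ 2 / 2 + k / ‖x s‖) 0 s := by
    intro s
    have hpos : 0 < ‖x s‖ := norm_pos_iff.2 (hx0 s)
    have hn : HasDerivAt (fun s => ‖x s‖) (inner ℝ (x s) (v s) / ‖x s‖) s := by
      have h := (hx s).norm_sq.sqrt (by positivity)
      simp only [Real.sqrt_sq (norm_nonneg _)] at h
      refine h.congr_deriv ?_
      field_simp
    refine (((hv s).norm_sq.div_const 2).add
      ((hasDerivAt_const s k).div hn hpos.ne')).congr_deriv ?_
    rw [inner_smul_right, inner_smul_right, real_inner_comm]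
    field_simp
    ring
  exact is_const_of_deriv_eq_zero (fun s => (hder s).differentiableAt) (fun s => (hder s).deriv) t 0

/-- A particle in a repulsive Coulomb field escapes at least linearly in time. -/
theorem coulomb_exists_linear_le_norm (hk : 0 < k) (hx0 : ∀ t, x t ≠ 0)
    (hx : ∀ t, HasDerivAt x (v t) t)
    (hv : ∀ t, HasDerivAt v (k • (‖x t‖ ^ 3)⁻¹ • x t) t) :
    ∃ c > 0, ∃ T, 1 ≤ T ∧ ∀ t, T ≤ t → c * t ≤ ‖x t‖ := by
  set E := ‖v 0‖ ^ 2 / 2 + k / ‖x 0‖ with hE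
  have hE0 : 0 < E := by
    have : 0 < ‖x 0‖ := norm_pos_iff.2 (hx0 0)
    positivity
  have hen := coulomb_energy_const hx0 hx hv
  have hw : ∀ t, HasDerivAt (fun t => inner ℝ (x t) (v t) - E * t)
      (‖v t‖ ^ 2 + k / ‖x t‖ - E) t := by
    intro t
    have hpos : 0 < ‖x t‖ := norm_pos_iff.2 (hx0 t)
    refine (((hx t).inner ℝ (hv t)).sub ((hasDerivAt_id t).const_mul E)).congr_deriv ?_
    rw [inner_smul_right, inner_smul_right, real_inner_self_eq_norm_sq, real_inner_self_eq_norm_sq]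
    field_simp
    ring
  have hwmono : Monotone (fun t => inner ℝ (x t) (v t) - E * t) := by
    refine monotone_of_deriv_nonneg (fun t => (hw t).differentiableAt) fun t => ?_
    rw [(hw t).deriv]
    nlinarith [hen t, sq_nonneg ‖v t‖]
  set w₀ := inner ℝ (x 0) (v 0)
  have hu : ∀ t, HasDerivAt (fun t => ‖x t‖ ^ 2 - 2 * w₀ * t - E * t ^ 2)
      (2 * inner ℝ (x t) (v t) - 2 * w₀ - E * (2 * t)) t := by
    intro t
    refine (((hx t).norm_sq.sub ((hasDerivAt_id t).const_mul (2 * w₀))).sub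
      ((hasDerivAt_pow 2 t).const_mul E)).congr_deriv ?_
    simp
  have humono : MonotoneOn (fun t => ‖x t‖ ^ 2 - 2 * w₀ * t - E * t ^ 2) (Set.Ici 0) := by
    refine monotoneOn_of_deriv_nonneg (convex_Ici 0)
      (fun t _ => (hu t).continuousAt.continuousWithinAt)
      (fun t _ => (hu t).differentiableAt.differentiableWithinAt) fun t ht => ?_
    rw [interior_Ici, Set.mem_Ioi] at ht
    rw [(hu t).deriv]
    have := hwmono ht.le
    simp only [mul_zero, sub_zero] at this
    linarith
  refine ⟨√(E / 2), by positivity, max 1 (4 * |w₀| / E), le_max_left _ _, fun t ht => ?_⟩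
  have ht0 : 0 < t := one_pos.trans_le ((le_max_left _ _).trans ht)
  have ht1 : 4 * |w₀| ≤ t * E := (div_le_iff₀ hE0).1 ((le_max_right _ _).trans ht)
  have hmono := humono (Set.mem_Ici.2 le_rfl) (Set.mem_Ici.2 ht0.le) ht0.le
  simp only [mul_zero, sub_zero, ne_eq, OfNat.ofNat_ne_zero, not_false_eq_true, zero_pow] at hmono
  refine abs_le_of_sq_le_sq' ?_ (norm_nonneg _) |>.2
  rw [mul_pow, Real.sq_sqrt (by positivity)]
  nlinarith [sq_nonneg ‖x 0‖, neg_abs_le w₀]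

/-- The asymptotic velocity of a particle in a repulsive Coulomb field exists, is nonzero, and is
approached at rate `1 / t`. -/
theorem coulomb_exists_asymptotic_velocity [CompleteSpace F] (hk : 0 < k) (hx0 : ∀ t, x t ≠ 0)
    (hx : ∀ t, HasDerivAt x (v t) t)
    (hv : ∀ t, HasDerivAt v (k • (‖x t‖ ^ 3)⁻¹ • x t) t) {c T : ℝ} (hc : 0 < c) (hT : 1 ≤ T)
    (hlow : ∀ t, T ≤ t → c * t ≤ ‖x t‖) :
    ∃ vinf, vinf ≠ 0 ∧ Tendsto v atTop (𝓝 vinf) ∧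
      ∀ t, T ≤ t → ‖v t - vinf‖ ≤ k / c ^ 2 * t ^ (-1 : ℝ) := by
  have hT0 : 0 < T := one_pos.trans_le hT
  obtain ⟨vinf, hlim, hrate⟩ := exists_tendsto_of_norm_deriv_le_rpow (C := k / c ^ 2) (a := 1)
    hT0 one_pos (fun t _ => hv t) (fun t ht => by
      have ht0 : 0 < t := hT0.trans_le ht
      have hpos : 0 < ‖x t‖ := norm_pos_iff.2 (hx0 t)
      have h2 : t ^ (-1 - 1 : ℝ) = (t ^ 2)⁻¹ := by
        rw [show (-1 - 1 : ℝ) = -(2 : ℕ) by norm_num, Real.rpow_neg ht0.le, Real.rpow_natCast]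
      rw [norm_smul, norm_smul, Real.norm_of_nonneg hk.le, Real.norm_of_nonneg (by positivity), h2]
      calc k * ((‖x t‖ ^ 3)⁻¹ * ‖x t‖) = k / ‖x t‖ ^ 2 := by field_simp
        _ ≤ k / (c * t) ^ 2 := by gcongr; exact hlow t ht
        _ = _ := by field_simp)
  refine ⟨vinf, ?_, hlim, fun t ht => by simpa using hrate t ht⟩
  have hxtop : Tendsto (fun t => ‖x t‖) atTop atTop := by
    refine tendsto_atTop_mono' atTop ?_ (tendsto_id.const_mul_atTop hc)
    filter_upwards [eventually_ge_atTop T] with t ht using hlow t ht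
  have hE := ((hlim.norm.pow 2).div_const 2).add (hxtop.const_div_atTop k)
  have hconst := hE.congr (coulomb_energy_const hx0 hx hv)
  have heq := tendsto_nhds_unique hconst tendsto_const_nhds
  rintro rfl
  have : 0 < ‖x 0‖ := norm_pos_iff.2 (hx0 0)
  have : 0 < ‖v 0‖ ^ 2 / 2 + k / ‖x 0‖ := by positivity
  simp at heq
  linarith

/-- Dollard asymptotics of a trajectory in a repulsive Coulomb field. -/
theorem coulomb_exists_dollard_asymptotics [CompleteSpace F] (hk : 0 < k) (hx0 : ∀ t, x t ≠ 0)
    (hx : ∀ t, HasDerivAt x (v t) t)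
    (hv : ∀ t, HasDerivAt v (k • (‖x t‖ ^ 3)⁻¹ • x t) t) :
    ∃ xinf vinf : F, vinf ≠ 0 ∧
      Tendsto (fun t => x t - t • vinf + Real.log t • (k / ‖vinf‖ ^ 3) • vinf) atTop (𝓝 xinf) := by
  obtain ⟨c, hc, T, hT, hlow⟩ := coulomb_exists_linear_le_norm hk hx0 hx hv
  obtain ⟨vinf, hv0, hlim, hrate⟩ := coulomb_exists_asymptotic_velocity hk hx0 hx hv hc hT hlow
  have hT0 : 0 < T := one_pos.trans_le hT
  have hn0 : 0 < ‖vinf‖ := norm_pos_iff.2 hv0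
  have hdev : ∃ D, ∀ t, T ≤ t → ‖x t - t • vinf‖ ≤ D * t ^ (1 / 2 : ℝ) := by
    set A := k / c ^ 2
    have hA0 : 0 < A := by positivity
    refine ⟨‖x T - T • vinf‖ + 2 * A, fun t ht => ?_⟩
    have hle := norm_sub_le_sub_of_norm_deriv_le (f := fun t => x t - t • vinf)
      (f' := fun t => v t - vinf) (B := fun t => 2 * A * t ^ (1 / 2 : ℝ))
      (B' := fun t => A * t ^ (-(1 / 2) : ℝ)) (T := T)
      (fun s _ => ((hx s).sub ((hasDerivAt_id s).smul_const vinf)).congr_deriv (by simp))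
      (fun s hs => by
        refine ((Real.hasDerivAt_rpow_const (p := 1 / 2)
          (Or.inl (hT0.trans_le hs).ne')).const_mul (2 * A)).congr_deriv ?_
        norm_num
        ring)
      (fun s hs => (hrate s hs).trans (by
        gcongr
        · exact hT.trans hs
        · norm_num))
      le_rfl ht
    have h1 : 1 ≤ t ^ (1 / 2 : ℝ) := Real.one_le_rpow (hT.trans ht) (by norm_num)
    have h2 : 0 ≤ T ^ (1 / 2 : ℝ) := by positivity
    have h3 := norm_le_norm_add_norm_sub' (x t - t • vinf) (x T - T • vinf)
    nlinarith [norm_nonneg (x T - T • vinf), mul_nonneg hA0.le h2]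
  obtain ⟨D, hD⟩ := hdev
  set d := min c ‖vinf‖
  have hd0 : 0 < d := lt_min hc hn0
  set y : ℝ → F := fun t => v t - vinf + t⁻¹ • (k / ‖vinf‖ ^ 3) • vinf with hy
  obtain ⟨L, hL, hyrate⟩ := exists_tendsto_of_norm_deriv_le_rpow (f := y)
    (f' := fun t => k • ((‖x t‖ ^ 3)⁻¹ • x t - (‖t • vinf‖ ^ 3)⁻¹ • t • vinf))
    (C := 4 * k * D / d ^ 3) (a := 3 / 2) hT0 (by norm_num)
    (fun t ht => by
      have ht0 : 0 < t := hT0.trans_le ht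
      refine (((hv t).sub_const vinf).add
        ((hasDerivAt_inv ht0.ne').smul_const ((k / ‖vinf‖ ^ 3) • vinf))).congr_deriv ?_
      rw [norm_smul, Real.norm_of_nonneg ht0.le, smul_sub, sub_eq_add_neg]
      congr 1
      simp only [smul_smul, ← neg_smul]
      congr 1
      field_simp)
    (fun t ht => by
      have ht0 : 0 < t := hT0.trans_le ht
      have hb := norm_inv_cube_smul_sub_le (p := x t) (q := t • vinf) (r := d * t) (by positivity)
        (le_trans (by gcongr; exact min_le_left _ _) (hlow t ht))
        (by
          rw [norm_smul, Real.norm_of_nonneg ht0.le, mul_comm]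
          gcongr
          exact min_le_right _ _)
      have hp : t ^ (-(3 / 2) - 1 : ℝ) = t ^ (1 / 2 : ℝ) / t ^ 3 := by
        rw [← Real.rpow_natCast, ← Real.rpow_sub ht0]
        norm_num
      rw [norm_smul, Real.norm_of_nonneg hk.le, hp]
      calc _ ≤ k * (4 * (D * t ^ (1 / 2 : ℝ)) / (d * t) ^ 3) := by
            refine mul_le_mul_of_nonneg_left (hb.trans ?_) hk.le
            gcongr
            exact hD t ht
        _ = _ := by field_simp)
  have hL0 : L = 0 := by
    refine tendsto_nhds_unique hL ?_
    simpa using (hlim.sub_const vinf).add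
      (tendsto_inv_atTop_zero.smul_const ((k / ‖vinf‖ ^ 3) • vinf))
  obtain ⟨xinf, hxinf, -⟩ := exists_tendsto_of_norm_deriv_le_rpow
    (f := fun t => x t - t • vinf + Real.log t • (k / ‖vinf‖ ^ 3) • vinf)
    (f' := y) (C := 4 * k * D / d ^ 3 / (3 / 2)) (a := 1 / 2) hT0 (by norm_num)
    (fun t ht => (((hx t).sub ((hasDerivAt_id t).smul_const vinf)).add
      ((Real.hasDerivAt_log (hT0.trans_le ht).ne').smul_const
        ((k / ‖vinf‖ ^ 3) • vinf))).congr_deriv (by simp [hy]))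
    (fun t ht => by
      have := hyrate t ht
      rw [hL0, sub_zero] at this
      convert this using 3
      norm_num)
  exact ⟨xinf, vinf, hv0, hxinf⟩

end Coulomb

/-- **Classical infrared problem for the repulsive Coulomb potential.**
Let `x : ℝ → ℝ³ \ {0}` be twice differentiable with
`m x''(t) = (e²/4π) x(t)/|x(t)|³` for all `t`.  Then:
(i) there exist `x_∞` and `v_∞ ≠ 0` with
`|x(t) − x_∞ − t v_∞ + (e²/(4πm)) (v_∞/|v_∞|³) log t| → 0` as `t → ∞`; and
(ii) for no `x₀, v₀` does `|x(t) − x₀ − t v₀| → 0` as `t → ∞`: the trajectory is not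
asymptotic to any free trajectory. -/
theorem coulomb_trajectory_log_asymptotics
    (m e : ℝ) (hm : 0 < m) (he : 0 < e)
    (x : ℝ → V3) (hx0 : ∀ t, x t ≠ 0)
    (hd1 : Differentiable ℝ x) (hd2 : Differentiable ℝ (deriv x))
    (heq : ∀ t : ℝ, m • deriv (deriv x) t = (e ^ 2 / (4 * π)) • (‖x t‖ ^ 3)⁻¹ • x t) :
    (∃ xinf vinf : V3, vinf ≠ 0 ∧
      Tendsto (fun t : ℝ =>
          ‖x t - xinf - t • vinf
            + ((e ^ 2 / (4 * π * m)) * Real.log t / ‖vinf‖ ^ 3) • vinf‖)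
        atTop (𝓝 0)) ∧
    (∀ x₀ v₀ : V3,
      ¬ Tendsto (fun t : ℝ => ‖x t - x₀ - t • v₀‖) atTop (𝓝 0)) := by
  set k := e ^ 2 / (4 * π * m) with hkdef
  have hk : 0 < k := by positivity
  have hx : ∀ t, HasDerivAt x (deriv x t) t := fun t => (hd1 t).hasDerivAt
  have hv : ∀ t, HasDerivAt (deriv x) (k • (‖x t‖ ^ 3)⁻¹ • x t) t := by
    intro t
    refine (hd2 t).hasDerivAt.congr_deriv ?_
    have hacc : k = m⁻¹ * (e ^ 2 / (4 * π)) := by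
      rw [hkdef]
      field_simp
    rw [hacc, mul_smul, ← heq t, inv_smul_smul₀ hm.ne']
  obtain ⟨xinf, vinf, hv0, hlim⟩ := coulomb_exists_dollard_asymptotics hk hx0 hx hv
  refine ⟨⟨xinf, vinf, hv0, ?_⟩, fun x₀ v₀ hfree => ?_⟩
  · have h := (hlim.sub_const xinf).norm
    rw [sub_self, norm_zero] at h
    refine h.congr fun t => congrArg _ ?_
    module
  · have hn0 : 0 < ‖vinf‖ := norm_pos_iff.2 hv0
    have hc : (k / ‖vinf‖ ^ 3) • vinf ≠ 0 := smul_ne_zero (by positivity) hv0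
    refine not_tendsto_add_smul_add_log_smul (a := x₀ - xinf) (b := v₀ - vinf) hc ?_
    have h := (hlim.sub_const xinf).sub (tendsto_zero_iff_norm_tendsto_zero.2 hfree)
    rw [sub_self, sub_zero] at h
    refine h.congr fun t => ?_
    module
end
end
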